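/- arXiv:2504.18656 — 8 statements merged into one kernel-verified Lean document; each statement's English description precedes it below -/
import Mathlib

section
/- Let k and m be positive integers with m ≤ k. In the polynomial ring ℚ[x,y], for 0 ≤ t ≤ m−1 define f_{2t+1} = Σ_{j=0}^{m−1−t} ((∏_{ℓ=1}^{t}(m−j−ℓ))/(∏_{ℓ=1}^{t}(m−ℓ)))·C(k+t,j)·x^j y^{k−j+t}, and for 1 ≤ t ≤ m−1 define f_{2t} = Σ_{j=0}^{m−1−t} ((∏_{ℓ=2}^{t}(m−j−ℓ))/(∏_{ℓ=1}^{t−1}(m−ℓ)))·C(k+t−1,j)·x^{j+1} y^{k−j+t−1}, where empty products equal 1 and C(·,·) denotes the binomial coefficient (all denominators are nonzero integers since m ≤ k and t < m). Then for every integer t with 1 ≤ t ≤ m−1 the following identities hold in ℚ[x,y]: (i) f_{2t+1} = y·f_{2t−1} − ((k+2t−m)/(m−t))·f_{2t}; and (ii) ((k+2t−m+1)/(k+t−m+1))·x·f_{2t+1} − ((t(k+t))/((k+t−m+1)(m−t)))·y·f_{2t} = Σ_{j=0}^{m−2−t} ((∏_{ℓ=2}^{t+1}(m−j−ℓ))/(∏_{ℓ=1}^{t}(m−ℓ)))·C(k+t,j)·x^{j+1}y^{k−j+t},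 i.e. the closed formula for f_{2t+2} satisfies the defining recursion. -/
open MvPolynomial Finset

/-- The polynomial `f_{2t+1}` from the paper, over `ℚ`. -/
noncomputable def fodd (k m t : ℕ) : MvPolynomial (Fin 2) ℚ :=
  ∑ j ∈ Finset.range (m - t),
    C (((∏ ℓ ∈ Finset.Icc 1 t, ((m : ℚ) - j - ℓ)) /
        (∏ ℓ ∈ Finset.Icc 1 t, ((m : ℚ) - ℓ))) * (Nat.choose (k + t) j : ℚ)) *
      X 0 ^ j * X 1 ^ (k - j + t)

/-- The polynomial `f_{2t}` from the paper, over `ℚ`. -/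
noncomputable def feven (k m t : ℕ) : MvPolynomial (Fin 2) ℚ :=
  ∑ j ∈ Finset.range (m - t),
    C (((∏ ℓ ∈ Finset.Icc 2 t, ((m : ℚ) - j - ℓ)) /
        (∏ ℓ ∈ Finset.Icc 1 (t - 1), ((m : ℚ) - ℓ))) * (Nat.choose (k + t - 1) j : ℚ)) *
      X 0 ^ (j + 1) * X 1 ^ (k - j + t - 1)

theorem prod_Icc_two_sub (z : ℚ) (s : ℕ) :
    ∏ ℓ ∈ Finset.Icc 2 (s + 1), (z - ℓ) = ∏ ℓ ∈ Finset.Icc 1 s, (z - 1 - ℓ) := by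
  induction s with
  | zero => simp
  | succ s ih =>
    rw [Finset.prod_Icc_succ_top (by omega), ih, Finset.prod_Icc_succ_top (by omega)]
    push_cast
    ring

theorem prod_Icc_one_sub (z : ℚ) (s : ℕ) :
    ∏ ℓ ∈ Finset.Icc 1 (s + 1), (z - ℓ) = (z - 1) * ∏ ℓ ∈ Finset.Icc 1 s, (z - 1 - ℓ) := by
  rw [← prod_Icc_two_sub, ← Finset.mul_prod_Ioc_eq_prod_Icc (by omega : 1 ≤ s + 1)]
  push_cast
  rfl

theorem prod_Icc_natCast_sub_ne_zero {m s : ℕ} (h : s < m) :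
    ∏ ℓ ∈ Finset.Icc 1 s, ((m : ℚ) - ℓ) ≠ 0 := by
  refine Finset.prod_ne_zero_iff.mpr fun ℓ hℓ => ?_
  rw [Finset.mem_Icc] at hℓ
  exact sub_ne_zero.mpr (by norm_cast; omega)

/-- `C(N+1, j) (N + 1 - j) = (N + 1) C(N, j)` over `ℚ`, without truncated subtraction. -/
theorem choose_succ_mul_sub {N j : ℕ} (h : j ≤ N) :
    ((N + 1).choose j : ℚ) * (N + 1 - j) = (N + 1) * N.choose j := by
  have := Nat.choose_mul_succ_eq N j
  have hc : ((N + 1 - j : ℕ) : ℚ) = N + 1 - j := by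
    rw [Nat.cast_sub (by omega)]; push_cast; rfl
  rw [← hc, mul_comm ((N : ℚ) + 1)]
  exact_mod_cast this.symm

/-- The odd recursion `f_{2t+1} = y f_{2t-1} - ((k+2t-m)/(m-t)) f_{2t}`. -/
theorem fodd_succ {k m s : ℕ} (hmk : m ≤ k) (hs : s + 1 < m) :
    fodd k m (s + 1) = X 1 * fodd k m s
      - C (((k : ℚ) + 2 * (s + 1 : ℕ) - m) / ((m : ℚ) - (s + 1 : ℕ))) * feven k m (s + 1) := by
  obtain ⟨r, rfl⟩ : ∃ r, m = r + (s + 1) := ⟨m - (s + 1), by omega⟩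
  have hr : (r : ℚ) ≠ 0 := by norm_cast; omega
  have hP := prod_Icc_natCast_sub_ne_zero (m := r + (s + 1)) (s := s) (by omega)
  have hext : fodd k (r + (s + 1)) (s + 1) = ∑ j ∈ Finset.range (r + 1),
      C (((∏ ℓ ∈ Finset.Icc 1 (s + 1), (((r + (s + 1) : ℕ) : ℚ) - j - ℓ)) /
        (∏ ℓ ∈ Finset.Icc 1 (s + 1), (((r + (s + 1) : ℕ) : ℚ) - ℓ))) *
          (Nat.choose (k + (s + 1)) j : ℚ)) * X 0 ^ j * X 1 ^ (k - j + (s + 1)) := by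
    have hzero : ∏ ℓ ∈ Finset.Icc 1 (s + 1), (((r + (s + 1) : ℕ) : ℚ) - r - ℓ) = 0 :=
      Finset.prod_eq_zero (i := s + 1) (by simp) (by push_cast; ring)
    rw [Finset.sum_range_succ, hzero, fodd, Nat.add_sub_cancel]
    simp
  rw [hext, fodd, feven, show r + (s + 1) - s = r + 1 by omega, Nat.add_sub_cancel,
    Finset.sum_range_succ', Finset.sum_range_succ', mul_add, Finset.mul_sum, Finset.mul_sum,
    add_sub_right_comm, ← Finset.sum_sub_distrib]
  congr 1
  · refine Finset.sum_congr rfl fun j hj => ?_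
    rw [Finset.mem_range] at hj
    rw [prod_Icc_two_sub, Finset.prod_Icc_succ_top (by omega), Finset.prod_Icc_succ_top (by omega),
      show k - j + (s + 1) - 1 = k - (j + 1) + (s + 1) by omega,
      show k - (j + 1) + (s + 1) = k - (j + 1) + s + 1 by omega,
      show k + (s + 1) - 1 = k + s by omega, show k + (s + 1) = k + s + 1 by omega,
      Nat.add_sub_cancel]
    have hz : ((r + (s + 1) : ℕ) : ℚ) - j - 1 = ((r + (s + 1) : ℕ) : ℚ) - (j + 1 : ℕ) := by
      push_cast; ring
    rw [hz]
    set P := ∏ ℓ ∈ Finset.Icc 1 s, (((r + (s + 1) : ℕ) : ℚ) - ℓ)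
    set Q := ∏ ℓ ∈ Finset.Icc 1 s, (((r + (s + 1) : ℕ) : ℚ) - (j + 1 : ℕ) - ℓ)
    have hpas : ((k + s + 1).choose (j + 1) : ℚ) = (k + s).choose j + (k + s).choose (j + 1) := by
      exact_mod_cast Nat.choose_succ_succ (k + s) j
    have habs : ((k : ℚ) + s + 1) * (k + s).choose j = (k + s + 1).choose (j + 1) * (j + 1) := by
      exact_mod_cast Nat.add_one_mul_choose_eq (k + s) j
    have hcoef : Q * (((r + (s + 1) : ℕ) : ℚ) - (j + 1 : ℕ) - (s + 1 : ℕ)) /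
          (P * (((r + (s + 1) : ℕ) : ℚ) - (s + 1 : ℕ))) * ((k + s + 1).choose (j + 1) : ℚ) =
        Q / P * ((k + s).choose (j + 1) : ℚ) -
          ((k : ℚ) + 2 * (s + 1 : ℕ) - (r + (s + 1) : ℕ)) /
            (((r + (s + 1) : ℕ) : ℚ) - (s + 1 : ℕ)) * (Q / P * ((k + s).choose j : ℚ)) := by
      have h1 : ((r + (s + 1) : ℕ) : ℚ) - (s + 1 : ℕ) = r := by push_cast; ring
      rw [h1]
      field_simp
      push_cast
      linear_combination Q * ((r : ℚ) * hpas + habs)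
    rw [hcoef, map_sub, map_mul (C) (_ / _) (_ * _)]
    ring
  · have hP' := prod_Icc_natCast_sub_ne_zero hs
    simp only [Nat.cast_zero, sub_zero, div_self hP, div_self hP', Nat.choose_zero_right, pow_zero,
      Nat.cast_one, mul_one, map_one, one_mul, Nat.sub_zero]
    ring

/-- The even recursion, expressing the closed formula for `f_{2t+2}` by `f_{2t+1}` and `f_{2t}`. -/
theorem feven_succ {k m s : ℕ} (hmk : m ≤ k) (hs : s + 1 < m) :
    C (((k : ℚ) + 2 * (s + 1 : ℕ) - m + 1) / ((k : ℚ) + (s + 1 : ℕ) - m + 1)) *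
        (X 0 * fodd k m (s + 1))
      - C ((((s + 1 : ℕ) : ℚ) * ((k : ℚ) + (s + 1 : ℕ))) /
          ((((k : ℚ) + (s + 1 : ℕ) - m + 1)) * ((m : ℚ) - (s + 1 : ℕ)))) *
            (X 1 * feven k m (s + 1))
      = ∑ j ∈ Finset.range (m - 1 - (s + 1)),
          C (((∏ ℓ ∈ Finset.Icc 2 (s + 1 + 1), ((m : ℚ) - j - ℓ)) /
              (∏ ℓ ∈ Finset.Icc 1 (s + 1), ((m : ℚ) - ℓ))) *
                (Nat.choose (k + (s + 1)) j : ℚ)) *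
            X 0 ^ (j + 1) * X 1 ^ (k - j + (s + 1)) := by
  have hext : ∑ j ∈ Finset.range (m - 1 - (s + 1)),
      (C (((∏ ℓ ∈ Finset.Icc 2 (s + 1 + 1), ((m : ℚ) - j - ℓ)) /
          (∏ ℓ ∈ Finset.Icc 1 (s + 1), ((m : ℚ) - ℓ))) * (Nat.choose (k + (s + 1)) j : ℚ)) *
        X 0 ^ (j + 1) * X 1 ^ (k - j + (s + 1)) : MvPolynomial (Fin 2) ℚ) =
      ∑ j ∈ Finset.range (m - (s + 1)),
      C (((∏ ℓ ∈ Finset.Icc 2 (s + 1 + 1), ((m : ℚ) - j - ℓ)) /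
          (∏ ℓ ∈ Finset.Icc 1 (s + 1), ((m : ℚ) - ℓ))) * (Nat.choose (k + (s + 1)) j : ℚ)) *
        X 0 ^ (j + 1) * X 1 ^ (k - j + (s + 1)) := by
    obtain ⟨d, rfl⟩ : ∃ d, m = d + (s + 2) := ⟨m - (s + 2), by omega⟩
    have hzero : ∏ ℓ ∈ Finset.Icc 2 (s + 1 + 1), (((d + (s + 2) : ℕ) : ℚ) - d - ℓ) = 0 :=
      Finset.prod_eq_zero (i := s + 1 + 1) (by simp) (by push_cast; ring)
    rw [show d + (s + 2) - (s + 1) = d + 1 by omega, show d + (s + 2) - 1 - (s + 1) = d by omega,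
      Finset.sum_range_succ, hzero]
    simp
  rw [hext, fodd, feven, Finset.mul_sum, Finset.mul_sum, Finset.mul_sum, Finset.mul_sum,
    ← Finset.sum_sub_distrib]
  refine Finset.sum_congr rfl fun j hj => ?_
  rw [Finset.mem_range] at hj
  have hP := prod_Icc_natCast_sub_ne_zero (m := m) (s := s) (by omega)
  rw [prod_Icc_two_sub, prod_Icc_two_sub, prod_Icc_one_sub ((m : ℚ) - j),
    Finset.prod_Icc_succ_top (by omega) (fun ℓ : ℕ => (m : ℚ) - ℓ),
    Finset.prod_Icc_succ_top (by omega) (fun ℓ : ℕ => (m : ℚ) - j - 1 - ℓ),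
    show k - j + (s + 1) - 1 = k - j + s by omega, show k - j + (s + 1) = k - j + s + 1 by omega,
    show k + (s + 1) - 1 = k + s by omega, show k + (s + 1) = k + s + 1 by omega,
    Nat.add_sub_cancel]
  set P := ∏ ℓ ∈ Finset.Icc 1 s, ((m : ℚ) - ℓ)
  set Q := ∏ ℓ ∈ Finset.Icc 1 s, ((m : ℚ) - j - 1 - ℓ)
  have habs := choose_succ_mul_sub (N := k + s) (j := j) (by omega)
  have hd : (m : ℚ) - (s + 1 : ℕ) ≠ 0 := sub_ne_zero.mpr (by norm_cast; omega)
  have he : (k : ℚ) + (s + 1 : ℕ) - m + 1 ≠ 0 := by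
    apply ne_of_gt
    have : (m : ℚ) ≤ k := by exact_mod_cast hmk
    push_cast
    have hs0 : (0 : ℚ) ≤ s := s.cast_nonneg
    linarith
  have hcoef : Q * ((m : ℚ) - j - 1 - (s + 1 : ℕ)) / (P * ((m : ℚ) - (s + 1 : ℕ))) *
        ((k + s + 1).choose j : ℚ) =
      ((k : ℚ) + 2 * (s + 1 : ℕ) - m + 1) / ((k : ℚ) + (s + 1 : ℕ) - m + 1) *
        (((m : ℚ) - j - 1) * Q / (P * ((m : ℚ) - (s + 1 : ℕ))) * ((k + s + 1).choose j : ℚ)) -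
      ((s + 1 : ℕ) : ℚ) * ((k : ℚ) + (s + 1 : ℕ)) /
        (((k : ℚ) + (s + 1 : ℕ) - m + 1) * ((m : ℚ) - (s + 1 : ℕ))) *
          (Q / P * ((k + s).choose j : ℚ)) := by
    field_simp
    push_cast at habs ⊢
    linear_combination Q * (-(s : ℚ) - 1) * habs
  rw [hcoef, map_sub, map_mul (C) (_ / _) (_ * _), map_mul (C) (_ / _) (Q / P * _)]
  ring

/-- The closed formulas for the `f_s` satisfy the defining recursions. -/
theorem stmt0 (k m : ℕ) (hk : 1 ≤ k) (hm : 1 ≤ m) (hmk : m ≤ k) :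
    ∀ t : ℕ, 1 ≤ t → t ≤ m - 1 →
      (fodd k m t = X 1 * fodd k m (t - 1)
          - C (((k : ℚ) + 2 * t - m) / ((m : ℚ) - t)) * feven k m t) ∧
      (C (((k : ℚ) + 2 * t - m + 1) / ((k : ℚ) + t - m + 1)) * (X 0 * fodd k m t)
          - C (((t : ℚ) * ((k : ℚ) + t)) / ((((k : ℚ) + t - m + 1)) * ((m : ℚ) - t))) *
              (X 1 * feven k m t)
        = ∑ j ∈ Finset.range (m - 1 - t),
            C (((∏ ℓ ∈ Finset.Icc 2 (t + 1), ((m : ℚ) - j - ℓ)) /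
                (∏ ℓ ∈ Finset.Icc 1 t, ((m : ℚ) - ℓ))) * (Nat.choose (k + t) j : ℚ)) *
              X 0 ^ (j + 1) * X 1 ^ (k - j + t)) := by
  intro t ht htm
  obtain ⟨s, rfl⟩ : ∃ s, t = s + 1 := ⟨t - 1, by omega⟩
  exact ⟨fodd_succ hmk (by omega), feven_succ hmk (by omega)⟩
end

section
/- Let K be a field and let m, n, k be positive integers with m ≤ k. Assume either that K has characteristic 0, or that K has characteristic p for a prime p with m + k ≤ p. In K[x,y], for 0 ≤ t ≤ m−1 define f_{2t+1} = Σ_{j=0}^{m−1−t} ((∏_{ℓ=1}^{t}(m−j−ℓ))/(∏_{ℓ=1}^{t}(m−ℓ)))·C(k+t,j)·x^j y^{k−j+t}, where the integer coefficients and the inverses of the denominators are interpreted in K (the denominators are invertible in K under the stated hypotheses). Let I = (x^m, y^n, (x+y)^k) ⊆ K[x,y]. Then, with respect to the lexicographic monomial order with x > y: each f_{2t+1} lies in I and has leading monomial x^{m−1−t} y^{k−m+2t+1}; and every nonzero g ∈ I has leading monomial divisible by x^m, by y^n, or by x^{m−1−t} y^{k−m+2t+1} for some 0 ≤ t ≤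 m−1. In other words, the set {x^m, y^n} ∪ {f_{2t+1} : 0 ≤ t ≤ m−1} is a Gröbner basis of I. -/
open MvPolynomial Finset

/-- `LeadPair g i j` says that `x^i y^j` is the leading monomial of `g` with respect to the
lexicographic monomial order with `x > y` on `K[x,y]`. -/
def LeadPair {K : Type*} [Field K] (g : MvPolynomial (Fin 2) K) (i j : ℕ) : Prop :=
  MvPolynomial.coeff (Finsupp.single 0 i + Finsupp.single 1 j) g ≠ 0 ∧
  ∀ i' j' : ℕ, MvPolynomial.coeff (Finsupp.single 0 i' + Finsupp.single 1 j') g ≠ 0 →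
    i' < i ∨ (i' = i ∧ j' ≤ j)

/-- The polynomial `f_{2t+1}` with its coefficients interpreted in the field `K`. -/
noncomputable def foddK (K : Type*) [Field K] (k m t : ℕ) : MvPolynomial (Fin 2) K :=
  ∑ j ∈ Finset.range (m - t),
    C (((∏ ℓ ∈ Finset.Icc 1 t, ((m : K) - j - ℓ)) /
        (∏ ℓ ∈ Finset.Icc 1 t, ((m : K) - ℓ))) * (Nat.choose (k + t) j : K)) *
      X 0 ^ j * X 1 ^ (k - j + t)

/-- If `x^M` divides `c - b (1+x)^k` with `deg b < s` and `deg c < M - s`, then `c = 0`, provided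
the positive integers below `M + k` are invertible in the field. -/
theorem eq_zero_of_eq_mul_one_add_X_pow_add {K : Type*} [Field K] (k : ℕ) (s : ℕ) :
    ∀ (M : ℕ) (c b A : Polynomial K), M ≤ k → (∀ r : ℕ, 1 ≤ r → r < M + k → (r : K) ≠ 0) →
      (∀ j, M ≤ j + s → c.coeff j = 0) → (∀ j, s ≤ j → b.coeff j = 0) →
      c = b * (1 + Polynomial.X) ^ k + Polynomial.X ^ M * A → c = 0 := by
  induction s with
  | zero =>
    intro M c b A _ _ hc hb h
    have hb0 : b = 0 := Polynomial.ext fun j => by simpa using hb j (Nat.zero_le j)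
    ext j
    by_cases hj : M ≤ j
    · simpa using hc j hj
    · rw [h, hb0, zero_mul, zero_add, Polynomial.coeff_X_pow_mul', if_neg hj, Polynomial.coeff_zero]
  | succ s ih =>
    intro M c b A hMk hr hc hb h
    rcases M with _ | M
    · exact Polynomial.ext fun j => by simpa using hc j (Nat.zero_le _)
    have coeff_euler (q : Polynomial K) (a : K) (j : ℕ) :
        ((1 + Polynomial.X) * Polynomial.derivative q - Polynomial.C a * q).coeff j
          = (j + 1) * q.coeff (j + 1) + (j - a) * q.coeff j := by
      rcases j with _ | j
      · simp [add_mul, Polynomial.coeff_derivative]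
        ring
      · simp [add_mul, Polynomial.coeff_derivative, Polynomial.coeff_X_mul]
        ring
    have hc1 : (1 + Polynomial.X) * Polynomial.derivative c - Polynomial.C ((k : K) + s) * c = 0 := by
      refine ih M _ ((1 + Polynomial.X) * Polynomial.derivative b - Polynomial.C (s : K) * b)
        ((1 + Polynomial.X) * (Polynomial.C ((M : K) + 1) * A
          + Polynomial.X * Polynomial.derivative A)
          - Polynomial.C ((k : K) + s) * Polynomial.X * A) (by omega)
        (fun r h1 h2 => hr r h1 (by omega)) ?_ ?_ ?_
      · intro j hj
        rw [coeff_euler, hc j (by omega), hc (j + 1) (by omega)]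
        simp
      · intro j hj
        rw [coeff_euler, hb (j + 1) (by omega)]
        rcases hj.eq_or_lt with rfl | hj
        · simp
        · simp [hb j hj]
      · have hk : k = (k - 1) + 1 := by omega
        have hd : (1 + Polynomial.X : Polynomial K) * Polynomial.derivative ((1 + Polynomial.X) ^ k)
            = Polynomial.C (k : K) * (1 + Polynomial.X) ^ k := by
          rw [Polynomial.derivative_pow]
          conv_rhs => rw [hk, pow_succ]
          rw [← hk]
          simp
          ring
        have hX : Polynomial.derivative (Polynomial.X ^ (M + 1) : Polynomial K)
            = Polynomial.C ((M : K) + 1) * Polynomial.X ^ M := by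
          simp
        rw [h, Polynomial.derivative_add, Polynomial.derivative_mul, Polynomial.derivative_mul, hX]
        simp only [Polynomial.C_add]
        linear_combination b * hd
    by_contra hne
    have hlead : c.coeff c.natDegree ≠ 0 := by simpa using hne
    have hdeg : c.natDegree + (s + 1) < M + 1 := by
      by_contra hlt
      exact hlead (hc _ (by omega))
    have h0 := coeff_euler c (k + s) c.natDegree
    rw [hc1, Polynomial.coeff_eq_zero_of_natDegree_lt (Nat.lt_succ_self _)] at h0
    have hz : ((k + s - c.natDegree : ℕ) : K) = 0 := by
      rw [Nat.cast_sub (by omega)]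
      push_cast
      have := (mul_eq_zero.mp (by simpa using h0.symm)).resolve_right hlead
      linear_combination -this
    exact hr _ (by omega) (by omega) hz

/-- The substitution `x ↦ x T`, `y ↦ T`, whose coefficient at `T^d` is the dehomogenization of the
homogeneous component of degree `d`. -/
noncomputable def gradeHom (K : Type*) [Field K] :
    MvPolynomial (Fin 2) K →ₐ[K] Polynomial (Polynomial K) :=
  aeval ![Polynomial.C Polynomial.X * Polynomial.X, Polynomial.X]

theorem coeff_coeff_gradeHom {K : Type*} [Field K] (g : MvPolynomial (Fin 2) K) (d i : ℕ) :
    ((gradeHom K g).coeff d).coeff i =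
      if i ≤ d then MvPolynomial.coeff (Finsupp.single 0 i + Finsupp.single 1 (d - i)) g else 0 := by
  induction g using MvPolynomial.induction_on' with
  | add p q hp hq =>
    simp only [map_add, Polynomial.coeff_add, hp, hq, MvPolynomial.coeff_add]
    split_ifs <;> simp
  | monomial u a =>
    have h1 : gradeHom K (monomial u a) =
        Polynomial.C (Polynomial.C a * Polynomial.X ^ u 0) * Polynomial.X ^ (u 0 + u 1) := by
      rw [gradeHom, aeval_monomial, Finsupp.prod_fintype _ _ (by simp)]
      simp [Fin.prod_univ_two, Polynomial.algebraMap_apply]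
      ring
    have h2 : u = Finsupp.single 0 i + Finsupp.single 1 (d - i) ↔ u 0 = i ∧ u 1 = d - i := by
      refine ⟨fun h => by simp [h], fun ⟨h, h'⟩ => ?_⟩
      ext z
      fin_cases z <;> simp [h, h']
    rw [h1, Polynomial.coeff_C_mul, Polynomial.coeff_X_pow, MvPolynomial.coeff_monomial]
    simp only [h2]
    by_cases hd : d = u 0 + u 1
    · by_cases hi : i = u 0
      · simp [hd, hi]
      · simp [hd, Polynomial.coeff_X_pow, hi, Ne.symm hi]
    · rw [if_neg hd, mul_zero, Polynomial.coeff_zero]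
      split_ifs with h3 h4
      · omega
      · rfl
      · rfl

theorem gradeHom_X_zero (K : Type*) [Field K] :
    gradeHom K (X 0) = Polynomial.C Polynomial.X * Polynomial.X := by
  simp [gradeHom]

theorem gradeHom_X_one (K : Type*) [Field K] : gradeHom K (X 1) = Polynomial.X := by
  simp [gradeHom]

theorem exists_le_of_leadPair {K : Type*} [Field K] {m n k : ℕ} (hmk : m ≤ k)
    (hr : ∀ r : ℕ, 1 ≤ r → r < m + k → (r : K) ≠ 0) {g : MvPolynomial (Fin 2) K}
    (hg : g ∈ Ideal.span ({X 0 ^ m, X 1 ^ n, (X 0 + X 1) ^ k} : Set (MvPolynomial (Fin 2) K)))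
    {i j : ℕ} (hl : LeadPair g i j) :
    m ≤ i ∨ n ≤ j ∨ ∃ t : ℕ, t ≤ m - 1 ∧ m - 1 - t ≤ i ∧ k - m + 2 * t + 1 ≤ j := by
  by_contra! hcon
  obtain ⟨hi, hj, ht⟩ := hcon
  have hij := ht (m - 1 - i) (by omega) (by omega)
  obtain ⟨a, z, hz, rfl⟩ := Ideal.mem_span_insert.mp hg
  obtain ⟨b, c, rfl⟩ := Ideal.mem_span_pair.mp hz
  set g := a * X 0 ^ m + (b * X 1 ^ n + c * (X 0 + X 1) ^ k) with hgdef
  have hG : gradeHom K g = Polynomial.C (Polynomial.X ^ m) * gradeHom K a * Polynomial.X ^ m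
      + gradeHom K b * Polynomial.X ^ n
      + Polynomial.C ((1 + Polynomial.X) ^ k) * gradeHom K c * Polynomial.X ^ k := by
    simp only [hgdef, map_add, map_mul, map_pow, gradeHom_X_zero, gradeHom_X_one, map_one]
    rw [show (Polynomial.C Polynomial.X * Polynomial.X + Polynomial.X : Polynomial (Polynomial K))
      = (1 + Polynomial.C Polynomial.X) * Polynomial.X by ring, mul_pow, mul_pow]
    ring
  let lower (N : ℕ) (q : MvPolynomial (Fin 2) K) : Polynomial K :=
    (gradeHom K q * Polynomial.X ^ N).coeff (i + j)
  have hlower (N : ℕ) (q : MvPolynomial (Fin 2) K) (l : ℕ) (hl : i + j < l + N) :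
      (lower N q).coeff l = 0 := by
    simp only [lower, Polynomial.coeff_mul_X_pow']
    split_ifs
    · rw [coeff_coeff_gradeHom, if_neg (by omega)]
    · simp
  have hGd : (gradeHom K g).coeff (i + j) = Polynomial.X ^ m * lower m a + lower n b
      + (1 + Polynomial.X) ^ k * lower k c := by
    simp only [hG, lower, Polynomial.coeff_add, mul_assoc, Polynomial.coeff_C_mul]
  have htop (l : ℕ) (hil : i < l) : ((gradeHom K g).coeff (i + j)).coeff l = 0 := by
    rw [coeff_coeff_gradeHom]
    split_ifs
    · by_contra hne
      have := hl.2 _ _ hne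
      omega
    · rfl
  have hzero : (gradeHom K g).coeff (i + j) - lower n b = 0 := by
    refine eq_zero_of_eq_mul_one_add_X_pow_add k (i + j + 1 - k) m _ (lower k c) (lower m a) hmk hr
      ?_ ?_ ?_
    · intro l hl'
      rw [Polynomial.coeff_sub, htop l (by omega), hlower n b l (by omega), sub_zero]
    · intro l hl'
      exact hlower k c l (by omega)
    · rw [hGd]
      ring
  have hi0 := congrArg (fun q => Polynomial.coeff q i) hzero
  simp only [Polynomial.coeff_sub, hlower n b i (by omega), sub_zero, coeff_coeff_gradeHom,
    Polynomial.coeff_zero, if_pos (Nat.le_add_right i j), Nat.add_sub_cancel_left] at hi0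
  exact hl.1 hi0

/-- Applying a polynomial of degree `t` in the Euler operator `x ∂/∂x` to `(x+y)^N` leaves a multiple
of `(x+y)^(N-t)`. -/
theorem add_pow_dvd_sum_prod_sub_mul_choose {K : Type*} [Field K] (a : K) (k t N : ℕ)
    (hN : k + t ≤ N) :
    ((X 0 + X 1) ^ k : MvPolynomial (Fin 2) K) ∣
      ∑ j ∈ Finset.range (N + 1),
        C ((∏ ℓ ∈ Finset.Icc 1 t, (a - j - ℓ)) * (Nat.choose N j : K)) *
          X 0 ^ j * X 1 ^ (N - j) := by
  induction t generalizing k with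
  | zero =>
    refine (pow_dvd_pow _ hN).trans (dvd_of_eq ?_)
    rw [add_pow]
    refine Finset.sum_congr rfl fun j _ => ?_
    simp
    ring
  | succ t ih =>
    obtain ⟨q, hq⟩ := ih (k + 1) (by omega)
    have hstep : ∑ j ∈ Finset.range (N + 1),
        C ((∏ ℓ ∈ Finset.Icc 1 (t + 1), (a - j - ℓ)) * (Nat.choose N j : K)) *
          X 0 ^ j * X 1 ^ (N - j) =
        C (a - (t + 1)) * ((X 0 + X 1) ^ (k + 1) * q)
          - X 0 * pderiv 0 ((X 0 + X 1) ^ (k + 1) * q : MvPolynomial (Fin 2) K) := by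
      rw [← hq, map_sum, Finset.mul_sum, Finset.mul_sum, ← Finset.sum_sub_distrib]
      refine Finset.sum_congr rfl fun j _ => ?_
      have hx : X 0 * pderiv 0 (X 0 ^ j : MvPolynomial (Fin 2) K) = C (j : K) * X 0 ^ j := by
        rcases j with _ | j
        · simp
        · simp [Derivation.leibniz_pow]
          ring
      have hy : pderiv 0 (X 1 ^ (N - j) : MvPolynomial (Fin 2) K) = 0 := by
        simp [Derivation.leibniz_pow, pderiv_X]
      rw [Derivation.leibniz, Derivation.leibniz, hy, pderiv_C, Finset.prod_Icc_succ_top (by omega)]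
      simp only [smul_eq_mul, map_mul, map_sub, map_add, map_one, Nat.cast_add, Nat.cast_one]
      linear_combination (C (∏ ℓ ∈ Finset.Icc 1 t, (a - j - ℓ)) * C (Nat.choose N j : K)
        * X 1 ^ (N - j)) * hx
    rw [hstep]
    refine ⟨C (a - (t + 1)) * ((X 0 + X 1) * q)
      - X 0 * ((X 0 + X 1) * pderiv 0 q + C ((k : K) + 1) * q), ?_⟩
    rw [Derivation.leibniz, Derivation.leibniz_pow]
    simp [pderiv_X]
    ring

theorem foddK_mem {K : Type*} [Field K] {m n k t : ℕ} (hmk : m ≤ k) (ht : t < m) :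
    foddK K k m t ∈ Ideal.span ({X 0 ^ m, X 1 ^ n, (X 0 + X 1) ^ k} :
      Set (MvPolynomial (Fin 2) K)) := by
  let term (j : ℕ) : MvPolynomial (Fin 2) K :=
    C ((∏ ℓ ∈ Finset.Icc 1 t, ((m : K) - j - ℓ)) * (Nat.choose (k + t) j : K)) *
      X 0 ^ j * X 1 ^ (k + t - j)
  have hvanish (j : ℕ) (h1 : m - t ≤ j) (h2 : j < m) : term j = 0 := by
    have : ∏ ℓ ∈ Finset.Icc 1 t, ((m : K) - j - ℓ) = 0 := by
      refine Finset.prod_eq_zero (i := m - j) (Finset.mem_Icc.mpr (by omega)) ?_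
      rw [Nat.cast_sub h2.le, sub_self]
    simp only [term, this, zero_mul, map_zero]
  have hlow : foddK K k m t =
      C (∏ ℓ ∈ Finset.Icc 1 t, ((m : K) - ℓ))⁻¹ * ∑ j ∈ Finset.range m, term j := by
    rw [← Finset.sum_subset (Finset.range_subset_range.mpr (Nat.sub_le m t)), foddK, Finset.mul_sum]
    · refine Finset.sum_congr rfl fun j hj => ?_
      rw [Finset.mem_range] at hj
      rw [show k - j + t = k + t - j by omega, div_eq_mul_inv]
      simp only [term, map_mul]
      ring
    · intro j hj hj'
      rw [Finset.mem_range] at hj hj'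
      exact hvanish j (by omega) hj
  rw [hlow]
  refine Ideal.mul_mem_left _ _ ?_
  have hsplit := Finset.sum_range_add_sum_Ico term (show m ≤ k + t + 1 by omega)
  rw [← eq_sub_iff_add_eq] at hsplit
  rw [hsplit]
  refine sub_mem (Ideal.mem_of_dvd _ (add_pow_dvd_sum_prod_sub_mul_choose (m : K) k t (k + t) le_rfl)
    (Ideal.subset_span (by simp))) (sum_mem fun j hj => ?_)
  rw [Finset.mem_Ico] at hj
  exact Ideal.mul_mem_right _ _ (Ideal.mul_mem_left _ _
    (Ideal.mem_of_dvd _ (pow_dvd_pow _ hj.1) (Ideal.subset_span (by simp))))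

theorem coeff_foddK {K : Type*} [Field K] (m k t i j : ℕ) :
    MvPolynomial.coeff (Finsupp.single 0 i + Finsupp.single 1 j) (foddK K k m t) =
      if i < m - t ∧ j = k - i + t then
        ((∏ ℓ ∈ Finset.Icc 1 t, ((m : K) - i - ℓ)) /
          (∏ ℓ ∈ Finset.Icc 1 t, ((m : K) - ℓ))) * (Nat.choose (k + t) i : K)
      else 0 := by
  have hterm (a : K) (l l' : ℕ) :
      MvPolynomial.coeff (Finsupp.single 0 i + Finsupp.single 1 j)
        (C a * X 0 ^ l * X 1 ^ l' : MvPolynomial (Fin 2) K) =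
        if l = i ∧ j = l' then a else 0 := by
    rw [X_pow_eq_monomial, X_pow_eq_monomial, C_mul_monomial, monomial_mul, coeff_monomial]
    congr 1
    · refine propext ⟨fun h => ?_, fun ⟨h, h'⟩ => by rw [h, h']⟩
      have h0 := DFunLike.congr_fun h 0
      have h1 := DFunLike.congr_fun h 1
      simp at h0 h1
      exact ⟨h0, h1.symm⟩
    · simp
  rw [foddK, MvPolynomial.coeff_sum]
  simp only [hterm]
  by_cases hi : i < m - t
  · rw [Finset.sum_eq_single i (fun l _ hl => if_neg fun h => hl h.1)
      (fun h => absurd (Finset.mem_range.mpr hi) h)]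
    simp [hi]
  · rw [if_neg fun h => hi h.1]
    refine Finset.sum_eq_zero fun l hl => if_neg fun h => hi ?_
    rw [← h.1]
    exact Finset.mem_range.mp hl

theorem leadPair_foddK {K : Type*} [Field K] {m k t : ℕ} (hmk : m ≤ k) (ht : t < m)
    (hr : ∀ r : ℕ, 1 ≤ r → r < m + k → (r : K) ≠ 0) :
    LeadPair (foddK K k m t) (m - 1 - t) (k - m + 2 * t + 1) := by
  refine ⟨?_, fun i j hij => ?_⟩
  · rw [coeff_foddK, if_pos (by omega)]
    refine mul_ne_zero (div_ne_zero ?_ ?_) ?_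
    · refine Finset.prod_ne_zero_iff.mpr fun ℓ hℓ => ?_
      rw [Finset.mem_Icc] at hℓ
      rw [← Nat.cast_sub (by omega), ← Nat.cast_sub (by omega)]
      exact hr _ (by omega) (by omega)
    · refine Finset.prod_ne_zero_iff.mpr fun ℓ hℓ => ?_
      rw [Finset.mem_Icc] at hℓ
      rw [← Nat.cast_sub (by omega)]
      exact hr _ (by omega) (by omega)
    · have hfac (N : ℕ) (hN : N < m + k) : (N.factorial : K) ≠ 0 := by
        rw [← Finset.prod_range_add_one_eq_factorial, Nat.cast_prod]
        refine Finset.prod_ne_zero_iff.mpr fun l hl => hr _ (by omega) ?_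
        rw [Finset.mem_range] at hl
        omega
      intro h0
      have := Nat.choose_mul_factorial_mul_factorial (show m - 1 - t ≤ k + t by omega)
      apply hfac (k + t) (by omega)
      rw [← this]
      simp [h0]
  · rw [coeff_foddK] at hij
    have := (ite_ne_right_iff.mp hij).1
    omega

/-- If `m ≤ k` (and the characteristic is `0` or a prime `p ≥ m + k`), then
`x^m, y^n, f_{2t+1}` for `0 ≤ t ≤ m-1` form a Gröbner basis of `(x^m, y^n, (x+y)^k)`
with respect to the lexicographic order with `x > y`. -/
theorem stmt2 (K : Type*) [Field K] (m n k : ℕ) (hm : 1 ≤ m) (hn : 1 ≤ n) (hk : 1 ≤ k)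
    (hmk : m ≤ k)
    (hchar : CharP K 0 ∨ ∃ p : ℕ, p.Prime ∧ CharP K p ∧ m + k ≤ p) :
    (∀ t : ℕ, t ≤ m - 1 →
      foddK K k m t ∈ Ideal.span ({X 0 ^ m, X 1 ^ n, (X 0 + X 1) ^ k} :
          Set (MvPolynomial (Fin 2) K)) ∧
      LeadPair (foddK K k m t) (m - 1 - t) (k - m + 2 * t + 1)) ∧
    (∀ g ∈ Ideal.span ({X 0 ^ m, X 1 ^ n, (X 0 + X 1) ^ k} : Set (MvPolynomial (Fin 2) K)),
      g ≠ 0 → ∀ i j : ℕ, LeadPair g i j →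
        m ≤ i ∨ n ≤ j ∨ ∃ t : ℕ, t ≤ m - 1 ∧ m - 1 - t ≤ i ∧ k - m + 2 * t + 1 ≤ j) := by
  have hr : ∀ r : ℕ, 1 ≤ r → r < m + k → (r : K) ≠ 0 := by
    intro r h1 h2 h0
    rcases hchar with h | ⟨p, _, h, hp⟩
    · have := (CharP.cast_eq_zero_iff K 0 r).mp h0
      rw [zero_dvd_iff] at this
      omega
    · have := Nat.le_of_dvd h1 ((CharP.cast_eq_zero_iff K p r).mp h0)
      omega
  refine ⟨fun t ht => ⟨foddK_mem hmk (by omega), leadPair_foddK hmk (by omega) hr⟩, ?_⟩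
  intro g hg _ i j hl
  exact exists_le_of_leadPair hmk hr hg hl
end

section
/- Let K be a field and let k, m, n be positive integers with k < m. Assume either that K has characteristic 0, or that K has characteristic p for a prime p with m + k ≤ p. In K[x,y], for 0 ≤ t ≤ k−1 define g_t = Σ_{i=0}^{k−1−t} ( Σ_{j=i}^{k−1−t} (−1)^{m−j−t} ((∏_{ℓ=1}^{t}(k−j−ℓ))/(∏_{ℓ=1}^{t}(k−ℓ)))·C(m+t,j)·C(j,i) ) · x^i y^{m−i+t}, where the coefficients are interpreted in K (the denominators are invertible in K under the stated hypotheses). Let I = (x^m, y^n, (x+y)^k) ⊆ K[x,y]. Then, with respect to the lexicographic monomial order with x > y: (x+y)^k has leading monomial x^k, each g_t lies in I and has leading monomial x^{k−1−t} y^{m−k+2t+1}; and every nonzero g ∈ I has leading monomial divisible by x^k, by y^n, or by x^{k−1−t} y^{m−k+2t+1} for some 0 ≤ t ≤ k−1. In other words, the set {(x+y)^k, y^n} ∪ {g_t : 0 ≤ t ≤ k−1} is a Gröbner basis of I. -/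
open MvPolynomial Finset

/-- The polynomial `g_t` with its coefficients interpreted in the field `K`. -/
noncomputable def gpoly (K : Type*) [Field K] (k m t : ℕ) : MvPolynomial (Fin 2) K :=
  ∑ i ∈ Finset.range (k - t),
    C (∑ j ∈ Finset.Icc i (k - 1 - t),
        (-1 : K) ^ (m - j - t) *
          ((∏ ℓ ∈ Finset.Icc 1 t, ((k : K) - j - ℓ)) /
           (∏ ℓ ∈ Finset.Icc 1 t, ((k : K) - ℓ))) *
          (Nat.choose (m + t) j : K) * (Nat.choose j i : K)) *
      X 0 ^ i * X 1 ^ (m - i + t)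

/-- The identification of `K[x,y]` with `K[y][x]`. -/
noncomputable def toBivariate (K : Type*) [Field K] :
    MvPolynomial (Fin 2) K →ₐ[K] Polynomial (Polynomial K) :=
  aeval ![Polynomial.X, Polynomial.C Polynomial.X]

/-- The inverse of `toBivariate`. -/
noncomputable def ofBivariate (K : Type*) [Field K] :
    Polynomial (Polynomial K) →+* MvPolynomial (Fin 2) K :=
  Polynomial.eval₂RingHom (Polynomial.eval₂RingHom C (X 1)) (X 0)

section Bivariate

variable {K : Type*} [Field K]

@[simp] lemma toBivariate_X_zero : toBivariate K (X 0) = Polynomial.X := by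
  simp [toBivariate]

@[simp] lemma toBivariate_X_one :
    toBivariate K (X 1) = Polynomial.C Polynomial.X := by
  simp [toBivariate]

@[simp] lemma toBivariate_C (a : K) :
    toBivariate K (C a) = Polynomial.C (Polynomial.C a) := by
  simp [toBivariate, Polynomial.algebraMap_apply]

lemma ofBivariate_toBivariate (f : MvPolynomial (Fin 2) K) :
    ofBivariate K (toBivariate K f) = f := by
  induction f using MvPolynomial.induction_on with
  | C a => simp [ofBivariate]
  | add p q hp hq => rw [map_add, map_add, hp, hq]
  | mul_X p i hp =>
    rw [map_mul, map_mul, hp]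
    fin_cases i <;> simp [ofBivariate]

lemma coeff_coeff_toBivariate (f : MvPolynomial (Fin 2) K) (i j : ℕ) :
    ((toBivariate K f).coeff i).coeff j =
      MvPolynomial.coeff (Finsupp.single 0 i + Finsupp.single 1 j) f := by
  induction f using MvPolynomial.induction_on' with
  | add p q hp hq => simp [hp, hq]
  | monomial u a =>
    have h : toBivariate K (monomial u a) =
        Polynomial.C (Polynomial.C a * Polynomial.X ^ u 1) * Polynomial.X ^ u 0 := by
      rw [MvPolynomial.monomial_eq, Finsupp.prod_fintype _ _ (by simp)]
      simp [Fin.prod_univ_two]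
      ring
    have hu : u = Finsupp.single 0 i + Finsupp.single 1 j ↔ i = u 0 ∧ j = u 1 := by
      constructor
      · rintro rfl
        simp
      · rintro ⟨rfl, rfl⟩
        ext v
        fin_cases v <;> simp
    rw [h, Polynomial.coeff_C_mul_X_pow, MvPolynomial.coeff_monomial]
    simp only [hu]
    by_cases h0 : i = u 0 <;> by_cases h1 : j = u 1 <;> simp [h0, h1]

lemma leadPair_of_toBivariate {g : MvPolynomial (Fin 2) K} {i j : ℕ} {c : K} (hc : c ≠ 0)
    (hdeg : (toBivariate K g).natDegree ≤ i)
    (hcoeff : (toBivariate K g).coeff i = Polynomial.C c * Polynomial.X ^ j) :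
    LeadPair g i j := by
  refine ⟨?_, fun i' j' h => ?_⟩
  · rw [← coeff_coeff_toBivariate, hcoeff]
    simpa using hc
  · rw [← coeff_coeff_toBivariate] at h
    have hi : i' ≤ i := by
      by_contra! hlt
      exact h (by rw [Polynomial.coeff_eq_zero_of_natDegree_lt (hdeg.trans_lt hlt),
        Polynomial.coeff_zero])
    rcases hi.lt_or_eq with hlt | rfl
    · exact Or.inl hlt
    · rw [hcoeff, Polynomial.coeff_C_mul_X_pow] at h
      exact Or.inr ⟨rfl, le_of_eq (by by_contra hne; exact h (if_neg hne))⟩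

lemma LeadPair.natDegree_toBivariate {g : MvPolynomial (Fin 2) K} {i j : ℕ}
    (h : LeadPair g i j) :
    (toBivariate K g).natDegree ≤ i ∧ (toBivariate K g).coeff i ≠ 0 ∧
      ((toBivariate K g).coeff i).natDegree ≤ j := by
  obtain ⟨h0, h1⟩ := h
  simp only [← coeff_coeff_toBivariate] at h0 h1
  refine ⟨Polynomial.natDegree_le_iff_coeff_eq_zero.2 fun N hN => ?_, fun h => h0 (by simp [h]),
    Polynomial.natDegree_le_iff_coeff_eq_zero.2 fun N hN => ?_⟩
  · ext N'
    by_contra h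
    rcases h1 N N' h with h | h <;> omega
  · by_contra h
    rcases h1 i N h with h | h <;> omega

lemma natDegree_X_add_C_X_pow (k : ℕ) :
    ((Polynomial.X + Polynomial.C Polynomial.X : Polynomial (Polynomial K)) ^ k).natDegree = k := by
  rw [(Polynomial.monic_X_add_C _).natDegree_pow, Polynomial.natDegree_X_add_C, mul_one]

lemma leadPair_add_pow (k : ℕ) :
    LeadPair ((X 0 + X 1) ^ k : MvPolynomial (Fin 2) K) k 0 := by
  have hdeg := natDegree_X_add_C_X_pow (K := K) k
  have hmonic := (Polynomial.monic_X_add_C (Polynomial.X : Polynomial K)).pow k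
  refine leadPair_of_toBivariate one_ne_zero ?_ ?_ <;>
    simp only [map_pow, map_add, toBivariate_X_zero, toBivariate_X_one]
  · exact hdeg.le
  · simpa [Polynomial.Monic, Polynomial.leadingCoeff, hdeg] using hmonic

lemma coeff_X_mul_derivative {R : Type*} [CommRing R] (f : Polynomial R) (j : ℕ) :
    (Polynomial.X * Polynomial.derivative f).coeff j = f.coeff j * j := by
  cases j with
  | zero => simp
  | succ j => simp [Polynomial.coeff_derivative]

/-- Powers of `x + y` are eigenvectors of `(x + y) ∂/∂x`. -/
lemma X_add_C_mul_derivative {R : Type*} [CommRing R] (a b y : R) (j : ℕ) :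
    (Polynomial.X + Polynomial.C y) * Polynomial.derivative
        (Polynomial.C a * (Polynomial.X + Polynomial.C y) ^ j * Polynomial.C b) =
      (j : Polynomial R) *
        (Polynomial.C a * (Polynomial.X + Polynomial.C y) ^ j * Polynomial.C b) := by
  cases j with
  | zero => simp
  | succ j =>
    simp only [Polynomial.derivative_mul, Polynomial.derivative_C, Polynomial.derivative_pow,
      Polynomial.derivative_add, Polynomial.derivative_X, map_natCast, Nat.add_sub_cancel]
    ring

/-- Applying the operators `(k - ℓ) - z ∂/∂z` for `ℓ = 1, …, l` to `x ^ M = (z - y) ^ M`, where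
`z = x + y`, gives a multiple of `x ^ (M - l)` with a cofactor of `x`-degree at most `l`. -/
lemma exists_sum_choose_eq_X_pow_mul (k M l : ℕ) (hl : l ≤ M) :
    ∃ V : Polynomial (Polynomial K), V.natDegree ≤ l ∧
      V.coeff l = Polynomial.C (∏ ℓ ∈ Finset.Icc 1 l, ((k : K) - M - ℓ)) ∧
      ∑ j ∈ Finset.range (M + 1),
        Polynomial.C (Polynomial.C
          ((∏ ℓ ∈ Finset.Icc 1 l, ((k : K) - j - ℓ)) * (M.choose j : K))) *
          (Polynomial.X + Polynomial.C Polynomial.X) ^ j *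
          Polynomial.C (-Polynomial.X) ^ (M - j) = Polynomial.X ^ (M - l) * V := by
  induction l with
  | zero =>
    refine ⟨1, by simp, by simp, ?_⟩
    have h := add_pow (Polynomial.X + Polynomial.C Polynomial.X : Polynomial (Polynomial K))
      (Polynomial.C (-Polynomial.X)) M
    rw [Polynomial.C_neg, add_neg_cancel_right, ← Polynomial.C_neg] at h
    rw [Nat.sub_zero, mul_one, h]
    refine Finset.sum_congr rfl fun j _ => ?_
    simp only [Finset.Icc_eq_empty_of_lt one_pos, Finset.prod_empty, one_mul, map_natCast]
    ring
  | succ l ih =>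
    obtain ⟨V, hdeg, hcoeff, hsum⟩ := ih (by omega)
    obtain ⟨r, rfl⟩ : ∃ r, M = r + (l + 1) := ⟨M - (l + 1), by omega⟩
    set W : Polynomial (Polynomial K) :=
      Polynomial.C (Polynomial.C ((k : K) - (l + 1))) * (Polynomial.X * V) -
        (Polynomial.X + Polynomial.C Polynomial.X) *
          (Polynomial.C (Polynomial.C ((r : K) + 1)) * V +
            Polynomial.X * Polynomial.derivative V) with hW
    have hWcoeff (N : ℕ) (hN : l ≤ N) :
        W.coeff (N + 1) = Polynomial.C ((k : K) - (l + 1) - (r + 1) - N) * V.coeff N := by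
      have hV : V.coeff (N + 1) = 0 := Polynomial.coeff_eq_zero_of_natDegree_lt (by omega)
      rw [hW, Polynomial.coeff_sub, Polynomial.coeff_C_mul, Polynomial.coeff_X_mul, add_mul,
        Polynomial.coeff_add, Polynomial.coeff_X_mul, Polynomial.coeff_C_mul]
      simp only [Polynomial.coeff_add, Polynomial.coeff_C_mul, coeff_X_mul_derivative, hV]
      simp only [Polynomial.C_sub, Polynomial.C_add, map_natCast, Polynomial.C_1]
      ring
    refine ⟨W, Polynomial.natDegree_le_iff_coeff_eq_zero.2 fun N hN => ?_, ?_, ?_⟩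
    · obtain ⟨N, rfl⟩ : ∃ N', N = N' + 1 := ⟨N - 1, by omega⟩
      rw [hWcoeff N (by omega), Polynomial.coeff_eq_zero_of_natDegree_lt (by omega), mul_zero]
    · rw [hWcoeff l le_rfl, hcoeff, ← Polynomial.C_mul, Finset.prod_Icc_succ_top (by omega)]
      congr 1
      push_cast
      ring
    · have hr : r + (l + 1) - l = r + 1 := by omega
      have hr' : r + (l + 1) - (l + 1) = r := by omega
      have hXW : Polynomial.X ^ r * W =
          Polynomial.C (Polynomial.C ((k : K) - (l + 1))) * (Polynomial.X ^ (r + 1) * V) -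
            (Polynomial.X + Polynomial.C Polynomial.X) *
              Polynomial.derivative (Polynomial.X ^ (r + 1) * V) := by
        simp only [hW, Polynomial.derivative_mul, Polynomial.derivative_X_pow, Polynomial.C_sub,
          Polynomial.C_add, map_natCast, Polynomial.C_1, Nat.cast_add, Nat.cast_one,
          Nat.add_sub_cancel]
        ring
      rw [hr] at hsum
      rw [hr', hXW, ← hsum, Polynomial.derivative_sum, Finset.mul_sum, Finset.mul_sum,
        ← Finset.sum_sub_distrib]
      refine Finset.sum_congr rfl fun j _ => ?_
      rw [Finset.prod_Icc_succ_top (by omega), ← Polynomial.C_pow, X_add_C_mul_derivative]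
      simp only [Polynomial.C_sub, Polynomial.C_mul, Polynomial.C_add, map_natCast, Polynomial.C_1,
        Nat.cast_add, Nat.cast_one]
      ring

/-- A `K[y]`-submodule of `K[y][x]` containing the products of `T` with polynomials of each
`x`-degree below `k` with constant leading coefficient contains all products of `T` with
polynomials of `x`-degree below `k`. -/
lemma mul_mem_of_degree_lt {k : ℕ} (N : Submodule (Polynomial K) (Polynomial (Polynomial K)))
    (T : Polynomial (Polynomial K)) (U : ℕ → Polynomial (Polynomial K)) (c : ℕ → K)
    (hdeg : ∀ a < k, (U a).natDegree ≤ a)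
    (hcoeff : ∀ a < k, (U a).coeff a = Polynomial.C (c a)) (hc : ∀ a < k, c a ≠ 0)
    (hmem : ∀ a < k, T * U a ∈ N) (F : Polynomial (Polynomial K)) (hF : F.degree < k) :
    T * F ∈ N := by
  induction k generalizing F with
  | zero =>
    have : F = 0 := by simpa using hF
    simp [this]
  | succ a ih =>
    have hrec := ih (fun b hb => hdeg b (by omega)) (fun b hb => hcoeff b (by omega))
      (fun b hb => hc b (by omega)) (fun b hb => hmem b (by omega))
      (F - (F.coeff a * Polynomial.C (c a)⁻¹) • U a) (by
        rw [Polynomial.degree_lt_iff_coeff_zero] at hF ⊢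
        intro b hb
        rw [Polynomial.coeff_sub, Polynomial.coeff_smul]
        rcases hb.eq_or_lt with rfl | hlt
        · rw [hcoeff a (by omega), smul_eq_mul, mul_assoc, ← Polynomial.C_mul,
            inv_mul_cancel₀ (hc a (by omega))]
          simp
        · rw [hF b hlt, Polynomial.coeff_eq_zero_of_natDegree_lt
            ((hdeg a (by omega)).trans_lt hlt)]
          simp)
    rw [mul_sub, mul_smul_comm] at hrec
    exact (N.sub_mem_iff_left (N.smul_mem _ (hmem a (by omega)))).1 hrec

/-- If each `H s` has `x`-degree `s` and a constant leading coefficient, then the leading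
coefficient of a combination `∑ b s • H s` of `x`-degree `i` is divisible by every divisor of
`b i`. -/
lemma dvd_coeff_natDegree_sum {k : ℕ} (H : ℕ → Polynomial (Polynomial K))
    (b d : ℕ → Polynomial K) (c : ℕ → K) (hdeg : ∀ s < k, (H s).natDegree ≤ s)
    (hcoeff : ∀ s < k, (H s).coeff s = Polynomial.C (c s)) (hc : ∀ s < k, c s ≠ 0)
    (hb : ∀ s < k, d s ∣ b s) (i : ℕ) (hi : (∑ s ∈ range k, b s • H s).natDegree ≤ i)
    (hik : i < k) : d i ∣ (∑ s ∈ range k, b s • H s).coeff i := by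
  induction k with
  | zero => omega
  | succ a ih =>
    have htop : (∑ s ∈ range (a + 1), b s • H s).coeff a = b a * Polynomial.C (c a) := by
      rw [Finset.sum_range_succ, Polynomial.coeff_add, Polynomial.finsetSum_coeff,
        Finset.sum_eq_zero, zero_add, Polynomial.coeff_smul, hcoeff a (by omega), smul_eq_mul]
      intro s hs
      rw [Finset.mem_range] at hs
      rw [Polynomial.coeff_smul, Polynomial.coeff_eq_zero_of_natDegree_lt
        ((hdeg s (by omega)).trans_lt hs), smul_zero]
    rcases (Nat.lt_succ_iff.1 hik).eq_or_lt with rfl | hlt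
    · rw [htop]
      exact (hb i hik).mul_right _
    · have hz : b a = 0 := by
        rw [Polynomial.coeff_eq_zero_of_natDegree_lt (hi.trans_lt hlt)] at htop
        simpa [hc a (by omega)] using htop.symm
      rw [Finset.sum_range_succ, hz, zero_smul, add_zero] at hi ⊢
      exact ih (fun s hs => hdeg s (by omega)) (fun s hs => hcoeff s (by omega))
        (fun s hs => hc s (by omega)) (fun s hs => hb s (by omega)) hi hlt

/-- The coefficient of `x ^ i` in `gpoly`. -/
noncomputable def gcoeff (K : Type*) [Field K] (k m t i : ℕ) : K :=
  ∑ j ∈ Finset.Icc i (k - 1 - t),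
    (-1 : K) ^ (m - j - t) *
      ((∏ ℓ ∈ Finset.Icc 1 t, ((k : K) - j - ℓ)) / (∏ ℓ ∈ Finset.Icc 1 t, ((k : K) - ℓ))) *
      (Nat.choose (m + t) j : K) * (Nat.choose j i : K)

/-- The cofactor of the largest power of `y` dividing `gpoly`. -/
noncomputable def hpoly (K : Type*) [Field K] (k m t : ℕ) : Polynomial (Polynomial K) :=
  ∑ i ∈ Finset.range (k - t),
    Polynomial.C (Polynomial.C (gcoeff K k m t i) * Polynomial.X ^ (k - 1 - t - i)) *
      Polynomial.X ^ i

lemma toBivariate_gpoly {k m t : ℕ} (hkm : k < m) (ht : t < k) :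
    toBivariate K (gpoly K k m t) =
      Polynomial.C (Polynomial.X ^ (m - k + 2 * t + 1)) * hpoly K k m t := by
  rw [gpoly, hpoly, map_sum, Finset.mul_sum]
  refine Finset.sum_congr rfl fun i hi => ?_
  rw [Finset.mem_range] at hi
  have he : m - i + t = (m - k + 2 * t + 1) + (k - 1 - t - i) := by omega
  rw [he]
  simp only [map_mul, map_pow, toBivariate_C, toBivariate_X_zero, toBivariate_X_one, gcoeff]
  ring

lemma coeff_hpoly (k m t i : ℕ) : (hpoly K k m t).coeff i =
    if i < k - t then Polynomial.C (gcoeff K k m t i) * Polynomial.X ^ (k - 1 - t - i) else 0 := by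
  simp only [hpoly, Polynomial.finsetSum_coeff, Polynomial.coeff_C_mul_X_pow,
    Finset.sum_ite_eq, Finset.mem_range]

lemma natDegree_hpoly_le (k m t : ℕ) : (hpoly K k m t).natDegree ≤ k - 1 - t := by
  refine Polynomial.natDegree_le_iff_coeff_eq_zero.2 fun N hN => ?_
  rw [coeff_hpoly, if_neg (by omega)]

lemma coeff_hpoly_top {k m t : ℕ} (ht : t < k) :
    (hpoly K k m t).coeff (k - 1 - t) = Polynomial.C (gcoeff K k m t (k - 1 - t)) := by
  rw [coeff_hpoly, if_pos (by omega), Nat.sub_self, pow_zero, mul_one]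

lemma natCast_choose_ne_zero {N M j : ℕ} (hK : ∀ r : ℕ, 0 < r → r < N → (r : K) ≠ 0)
    (hM : M < N) (hj : j ≤ M) : (M.choose j : K) ≠ 0 := by
  have hfact : ∀ a < N, (a.factorial : K) ≠ 0 := by
    intro a
    induction a with
    | zero => simp
    | succ a ih =>
      intro ha
      rw [Nat.factorial_succ, Nat.cast_mul]
      exact mul_ne_zero (hK _ a.succ_pos ha) (ih (by omega))
  have h := hfact M hM
  rw [← Nat.choose_mul_factorial_mul_factorial hj, Nat.cast_mul, Nat.cast_mul, mul_assoc] at h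
  exact left_ne_zero_of_mul h

lemma prod_natCast_sub_ne_zero {N a t : ℕ} (hK : ∀ r : ℕ, 0 < r → r < N → (r : K) ≠ 0)
    (ha : a < N) (hta : t < a) : ∏ ℓ ∈ Finset.Icc 1 t, ((a : K) - ℓ) ≠ 0 := by
  refine Finset.prod_ne_zero_iff.2 fun ℓ hℓ => ?_
  rw [Finset.mem_Icc] at hℓ
  rw [← Nat.cast_sub (by omega)]
  exact hK _ (by omega) (by omega)

lemma gcoeff_top_ne_zero {k m t : ℕ} (hkm : k < m) (ht : t < k)
    (hK : ∀ r : ℕ, 0 < r → r < m + k → (r : K) ≠ 0) : gcoeff K k m t (k - 1 - t) ≠ 0 := by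
  have hprod := prod_natCast_sub_ne_zero hK (a := t + 1) (t := t) (by omega) (by omega)
  rw [gcoeff, Finset.Icc_self, Finset.sum_singleton, Nat.choose_self, Nat.cast_one, mul_one]
  refine mul_ne_zero (mul_ne_zero (by simp) (div_ne_zero ?_
    (prod_natCast_sub_ne_zero hK (by omega) ht)))
    (natCast_choose_ne_zero hK (by omega) (by omega))
  have hcast : (k : K) - (k - 1 - t : ℕ) = (t + 1 : ℕ) := by
    rw [sub_eq_iff_eq_add, ← Nat.cast_add]
    congr 1
    omega
  rwa [hcast]

/-- `gpoly` expanded in powers of `x + y`. -/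
lemma toBivariate_gpoly_eq_sum {k m t : ℕ} (hkm : k < m) (ht : t < k) :
    toBivariate K (gpoly K k m t) = ∑ j ∈ Finset.range (k - t),
      Polynomial.C (Polynomial.C (((∏ ℓ ∈ Finset.Icc 1 t, ((k : K) - j - ℓ)) /
          (∏ ℓ ∈ Finset.Icc 1 t, ((k : K) - ℓ))) * ((m + t).choose j : K))) *
        (Polynomial.X + Polynomial.C Polynomial.X) ^ j *
        Polynomial.C (-Polynomial.X) ^ (m + t - j) := by
  have hcomm (f : ℕ → ℕ → Polynomial (Polynomial K)) :
      ∑ i ∈ Finset.range (k - t), ∑ j ∈ Finset.Icc i (k - 1 - t), f i j =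
        ∑ j ∈ Finset.range (k - t), ∑ i ∈ Finset.range (j + 1), f i j := by
    refine Finset.sum_comm' fun i j => ?_
    simp only [Finset.mem_range, Finset.mem_Icc]
    omega
  simp only [gpoly, map_sum, map_mul, map_pow, toBivariate_C, toBivariate_X_zero,
    toBivariate_X_one, Finset.sum_mul]
  rw [hcomm]
  refine Finset.sum_congr rfl fun j hj => ?_
  rw [Finset.mem_range] at hj
  rw [add_pow, Finset.mul_sum, Finset.sum_mul]
  refine Finset.sum_congr rfl fun i hi => ?_
  rw [Finset.mem_range] at hi
  have hsign : (-1 : K) ^ (m + t - j) = (-1) ^ (m - j - t) := by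
    rw [show m + t - j = m - j - t + 2 * t by omega, pow_add, pow_mul, neg_one_sq, one_pow, mul_one]
  have hsign' : (Polynomial.C (Polynomial.C (-1 : K))) ^ (m + t - j) =
      Polynomial.C (Polynomial.C (-1)) ^ (m - j - t) := by
    simp only [← Polynomial.C_pow, hsign]
  have hneg : (Polynomial.C (-Polynomial.X) : Polynomial (Polynomial K)) =
      Polynomial.C (Polynomial.C (-1)) * Polynomial.C Polynomial.X := by
    rw [← Polynomial.C_mul, Polynomial.C_neg (a := (1 : K)), Polynomial.C_1, neg_one_mul]
  rw [hneg, mul_pow, hsign', show m + t - j = (m - i + t) - (j - i) by omega]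
  have hy : (Polynomial.C Polynomial.X : Polynomial (Polynomial K)) ^ (m - i + t) =
      Polynomial.C Polynomial.X ^ (j - i) * Polynomial.C Polynomial.X ^ (m - i + t - (j - i)) := by
    rw [← pow_add]
    congr 1
    omega
  rw [hy]
  simp only [map_natCast]
  ring

/-- Modulo `(x + y) ^ k`, the polynomial `gpoly` is a constant times `x ^ m` times a polynomial of
`x`-degree `t` with constant leading coefficient. -/
lemma exists_toBivariate_gpoly_eq {k m t : ℕ} (hkm : k < m) (ht : t < k)
    (hK : ∀ r : ℕ, 0 < r → r < m + k → (r : K) ≠ 0) :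
    ∃ (V Q : Polynomial (Polynomial K)) (c : K), c ≠ 0 ∧ V.natDegree ≤ t ∧
      V.coeff t = Polynomial.C c ∧
      toBivariate K (gpoly K k m t) = Polynomial.X ^ m * V +
        (Polynomial.X + Polynomial.C Polynomial.X) ^ k * Q := by
  obtain ⟨V, hdeg, hcoeff, hsum⟩ := exists_sum_choose_eq_X_pow_mul (K := K) k (m + t) t (by omega)
  set D : K := ∏ ℓ ∈ Finset.Icc 1 t, ((k : K) - ℓ) with hD
  have hD0 : D ≠ 0 := prod_natCast_sub_ne_zero hK (by omega) ht
  rw [Nat.add_sub_cancel, ← Finset.sum_range_add_sum_Ico _ (show k - t ≤ m + t + 1 by omega)]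
    at hsum
  obtain ⟨Q, hQ⟩ : (Polynomial.X + Polynomial.C Polynomial.X) ^ k ∣
      ∑ j ∈ Finset.Ico (k - t) (m + t + 1),
        Polynomial.C (Polynomial.C
          ((∏ ℓ ∈ Finset.Icc 1 t, ((k : K) - j - ℓ)) * ((m + t).choose j : K))) *
          (Polynomial.X + Polynomial.C Polynomial.X) ^ j *
          Polynomial.C (-Polynomial.X) ^ (m + t - j) := by
    refine Finset.dvd_sum fun j hj => ?_
    rw [Finset.mem_Ico] at hj
    rcases lt_or_ge j k with hjk | hjk
    · have hz : ∏ ℓ ∈ Finset.Icc 1 t, ((k : K) - j - ℓ) = 0 := by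
        refine Finset.prod_eq_zero (i := k - j) (Finset.mem_Icc.2 (by omega)) ?_
        rw [Nat.cast_sub hjk.le, sub_self]
      simp [hz]
    · exact ((pow_dvd_pow _ hjk).mul_left _).mul_right _
  refine ⟨Polynomial.C (Polynomial.C D⁻¹) * V, -(Polynomial.C (Polynomial.C D⁻¹) * Q),
    D⁻¹ * ∏ ℓ ∈ Finset.Icc 1 t, ((k : K) - (m + t : ℕ) - ℓ), ?_, ?_, ?_, ?_⟩
  · refine mul_ne_zero (inv_ne_zero hD0) (Finset.prod_ne_zero_iff.2 fun ℓ hℓ => ?_)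
    rw [Finset.mem_Icc] at hℓ
    have h := hK (m + t + ℓ - k) (by omega) (by omega)
    rw [Nat.cast_sub (by omega)] at h
    contrapose! h
    push_cast at h ⊢
    linear_combination -h
  · exact (Polynomial.natDegree_C_mul_le _ _).trans hdeg
  · rw [Polynomial.coeff_C_mul, hcoeff, Polynomial.C_mul]
  · rw [hQ] at hsum
    have hG : toBivariate K (gpoly K k m t) = Polynomial.C (Polynomial.C D⁻¹) *
        (Polynomial.X ^ m * V - (Polynomial.X + Polynomial.C Polynomial.X) ^ k * Q) := by
      rw [← hsum, add_sub_cancel_right, toBivariate_gpoly_eq_sum hkm ht, Finset.mul_sum]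
      refine Finset.sum_congr rfl fun j _ => ?_
      rw [← hD, div_eq_mul_inv]
      simp only [Polynomial.C_mul]
      ring
    rw [hG]
    ring

lemma gpoly_mem_span {k m t : ℕ} (n : ℕ) (hkm : k < m) (ht : t < k)
    (hK : ∀ r : ℕ, 0 < r → r < m + k → (r : K) ≠ 0) :
    gpoly K k m t ∈ Ideal.span ({X 0 ^ m, X 1 ^ n, (X 0 + X 1) ^ k} :
      Set (MvPolynomial (Fin 2) K)) := by
  obtain ⟨V, Q, c, -, -, -, h⟩ := exists_toBivariate_gpoly_eq hkm ht hK
  have h' : gpoly K k m t = X 0 ^ m * ofBivariate K V + (X 0 + X 1) ^ k * ofBivariate K Q := by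
    rw [← ofBivariate_toBivariate (gpoly K k m t), h]
    simp only [map_add, map_mul, map_pow]
    simp [ofBivariate]
  rw [h']
  exact Ideal.add_mem _ (Ideal.mul_mem_right _ _ (Ideal.subset_span (by simp)))
    (Ideal.mul_mem_right _ _ (Ideal.subset_span (by simp)))

lemma leadPair_gpoly {k m t : ℕ} (hkm : k < m) (ht : t < k)
    (hK : ∀ r : ℕ, 0 < r → r < m + k → (r : K) ≠ 0) :
    LeadPair (gpoly K k m t) (k - 1 - t) (m - k + 2 * t + 1) := by
  refine leadPair_of_toBivariate (gcoeff_top_ne_zero hkm ht hK) ?_ ?_ <;>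
    rw [toBivariate_gpoly hkm ht]
  · exact (Polynomial.natDegree_C_mul_le _ _).trans (natDegree_hpoly_le k m t)
  · rw [Polynomial.coeff_C_mul, coeff_hpoly_top ht, mul_comm]

lemma X_pow_dvd_coeff_of_natDegree_le {k m n : ℕ} (hkm : k < m)
    (hK : ∀ r : ℕ, 0 < r → r < m + k → (r : K) ≠ 0) (a b c : Polynomial (Polynomial K)) {i : ℕ}
    (hik : i < k)
    (hi : (Polynomial.X ^ m * a + Polynomial.C Polynomial.X ^ n * b +
      (Polynomial.X + Polynomial.C Polynomial.X) ^ k * c).natDegree ≤ i) :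
    Polynomial.X ^ min n (m - k + 2 * (k - 1 - i) + 1) ∣
      (Polynomial.X ^ m * a + Polynomial.C Polynomial.X ^ n * b +
        (Polynomial.X + Polynomial.C Polynomial.X) ^ k * c).coeff i := by
  set Z : Polynomial (Polynomial K) := (Polynomial.X + Polynomial.C Polynomial.X) ^ k with hZ
  have hZmonic : Z.Monic := (Polynomial.monic_X_add_C _).pow k
  have hZdeg : Z.natDegree = k := natDegree_X_add_C_X_pow k
  set e : ℕ → ℕ := fun s => min n (m - k + 2 * (k - 1 - s) + 1) with he
  set H : ℕ → Polynomial (Polynomial K) := fun s => hpoly K k m (k - 1 - s) with hH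
  have hHdeg (s : ℕ) (hs : s < k) : (H s).natDegree ≤ s :=
    (natDegree_hpoly_le k m _).trans (by omega)
  have hHcoeff (s : ℕ) (hs : s < k) :
      (H s).coeff s = Polynomial.C (gcoeff K k m (k - 1 - s) s) := by
    have h := coeff_hpoly_top (K := K) (m := m) (show k - 1 - s < k by omega)
    rwa [show k - 1 - (k - 1 - s) = s by omega] at h
  have hHne (s : ℕ) (hs : s < k) : gcoeff K k m (k - 1 - s) s ≠ 0 := by
    have h := gcoeff_top_ne_zero hkm (show k - 1 - s < k by omega) hK
    rwa [show k - 1 - (k - 1 - s) = s by omega] at h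
  set N : Submodule (Polynomial K) (Polynomial (Polynomial K)) :=
    (Ideal.span {Z}).restrictScalars (Polynomial K) ⊔
      Submodule.span (Polynomial K)
        ((fun s => (Polynomial.X ^ e s : Polynomial K) • H s) '' (Finset.range k)) with hN
  have hZN (F : Polynomial (Polynomial K)) : Z * F ∈ N :=
    Submodule.mem_sup_left (Ideal.mul_mem_right _ _ (Ideal.subset_span rfl))
  have hHN {s d : ℕ} (hs : s < k) (hd : e s ≤ d) :
      Polynomial.C (Polynomial.X ^ d) * H s ∈ N := by
    rw [← Polynomial.smul_eq_C_mul, ← Nat.sub_add_cancel hd, pow_add, mul_smul]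
    exact N.smul_mem _ (Submodule.mem_sup_right (Submodule.subset_span
      ⟨s, by simpa using hs, rfl⟩))
  have hreduce {T : Polynomial (Polynomial K)}
      (hT : ∀ F : Polynomial (Polynomial K), F.degree < k → T * F ∈ N)
      (F : Polynomial (Polynomial K)) : T * F ∈ N := by
    rw [← Polynomial.modByMonic_add_div F Z, mul_add, mul_left_comm]
    refine N.add_mem (hT _ ?_) (hZN _)
    have h := Polynomial.degree_modByMonic_lt F hZmonic
    rwa [Polynomial.degree_eq_natDegree hZmonic.ne_zero, hZdeg] at h
  have hyN : Polynomial.C Polynomial.X ^ n * b ∈ N := by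
    refine hreduce (fun F hF => mul_mem_of_degree_lt N _ H _ hHdeg hHcoeff hHne
      (fun s hs => ?_) F hF) b
    rw [← Polynomial.C_pow]
    exact hHN hs (min_le_left _ _)
  have hxN : Polynomial.X ^ m * a ∈ N := by
    have hV (t : ℕ) : ∃ (V : Polynomial (Polynomial K)) (c : K), t < k →
        c ≠ 0 ∧ V.natDegree ≤ t ∧ V.coeff t = Polynomial.C c ∧ Polynomial.X ^ m * V ∈ N := by
      by_cases ht : t < k
      · obtain ⟨V, Q, c, hc, hdeg, hcoeff, h⟩ := exists_toBivariate_gpoly_eq hkm ht hK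
        refine ⟨V, c, fun _ => ⟨hc, hdeg, hcoeff, ?_⟩⟩
        rw [eq_sub_of_add_eq h.symm, toBivariate_gpoly hkm ht]
        refine N.sub_mem ?_ (hZN Q)
        have hs : k - 1 - (k - 1 - t) = t := by omega
        have hmem := hHN (s := k - 1 - t) (d := m - k + 2 * t + 1) (by omega)
          (by simp only [he, hs]; exact min_le_right _ _)
        simpa only [hH, hs] using hmem
      · exact ⟨0, 0, fun h => absurd h ht⟩
    choose V c hV using hV
    exact hreduce (mul_mem_of_degree_lt N _ V c (fun t ht => (hV t ht).2.1)
      (fun t ht => (hV t ht).2.2.1) (fun t ht => (hV t ht).1) (fun t ht => (hV t ht).2.2.2)) a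
  have hmem := N.add_mem (N.add_mem hxN hyN) (hZN c)
  revert hmem hi
  generalize Polynomial.X ^ m * a + Polynomial.C Polynomial.X ^ n * b + Z * c = F
  intro hi hmem
  obtain ⟨G, hG, S, hS, rfl⟩ := Submodule.mem_sup.1 hmem
  obtain ⟨q, rfl⟩ := Ideal.mem_span_singleton.1 hG
  obtain ⟨u, rfl⟩ := (Submodule.mem_span_image_finset_iff_exists_fun' _).1 hS
  simp only [smul_smul] at hi ⊢
  have hSdeg : (∑ s ∈ range k, (u s * Polynomial.X ^ e s) • H s).degree < k := by
    refine (Polynomial.degree_lt_iff_coeff_zero _ _).2 fun r hr => ?_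
    rw [Polynomial.finsetSum_coeff]
    refine Finset.sum_eq_zero fun s hs => ?_
    rw [Finset.mem_range] at hs
    rw [Polynomial.coeff_smul, Polynomial.coeff_eq_zero_of_natDegree_lt
      ((hHdeg s hs).trans_lt (by omega)), smul_zero]
  have hq : q = 0 := by
    by_contra hq
    have hlt : (Z * q).degree < k := by
      have h : (Z * q + ∑ s ∈ range k, (u s * Polynomial.X ^ e s) • H s).degree < k :=
        (Polynomial.degree_le_of_natDegree_le hi).trans_lt (by exact_mod_cast hik)
      have h' := (Polynomial.degree_sub_le _ _).trans_lt (max_lt h hSdeg)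
      rwa [add_sub_cancel_right] at h'
    rw [Polynomial.degree_eq_natDegree (mul_ne_zero hZmonic.ne_zero hq),
      Polynomial.natDegree_mul hZmonic.ne_zero hq, hZdeg] at hlt
    norm_cast at hlt
    omega
  rw [hq, mul_zero, zero_add] at hi ⊢
  exact dvd_coeff_natDegree_sum H _ (fun s => Polynomial.X ^ e s) _ hHdeg hHcoeff hHne
    (fun s _ => dvd_mul_left _ _) i hi hik

lemma natCast_ne_zero_of_charP {N : ℕ}
    (hchar : CharP K 0 ∨ ∃ p : ℕ, p.Prime ∧ CharP K p ∧ N ≤ p) (r : ℕ) (hr : 0 < r)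
    (hrN : r < N) : (r : K) ≠ 0 := by
  rcases hchar with h | ⟨p, -, h, hp⟩
  · rw [Ne, CharP.cast_eq_zero_iff K 0, zero_dvd_iff]
    omega
  · rw [Ne, CharP.cast_eq_zero_iff K p]
    exact Nat.not_dvd_of_pos_of_lt hr (by omega)

end Bivariate

/-- If `k < m` (and the characteristic is `0` or a prime `p ≥ m + k`), then
`(x+y)^k, y^n, g_t` for `0 ≤ t ≤ k-1` form a Gröbner basis of `(x^m, y^n, (x+y)^k)`
with respect to the lexicographic order with `x > y`. -/
theorem stmt3 (K : Type*) [Field K] (k m n : ℕ) (hk : 1 ≤ k) (hm : 1 ≤ m) (hn : 1 ≤ n)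
    (hkm : k < m)
    (hchar : CharP K 0 ∨ ∃ p : ℕ, p.Prime ∧ CharP K p ∧ m + k ≤ p) :
    LeadPair ((X 0 + X 1) ^ k : MvPolynomial (Fin 2) K) k 0 ∧
    (∀ t : ℕ, t ≤ k - 1 →
      gpoly K k m t ∈ Ideal.span ({X 0 ^ m, X 1 ^ n, (X 0 + X 1) ^ k} :
          Set (MvPolynomial (Fin 2) K)) ∧
      LeadPair (gpoly K k m t) (k - 1 - t) (m - k + 2 * t + 1)) ∧
    (∀ g ∈ Ideal.span ({X 0 ^ m, X 1 ^ n, (X 0 + X 1) ^ k} : Set (MvPolynomial (Fin 2) K)),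
      g ≠ 0 → ∀ i j : ℕ, LeadPair g i j →
        k ≤ i ∨ n ≤ j ∨ ∃ t : ℕ, t ≤ k - 1 ∧ k - 1 - t ≤ i ∧ m - k + 2 * t + 1 ≤ j) := by
  have hK := natCast_ne_zero_of_charP hchar
  refine ⟨leadPair_add_pow k, fun t ht => ⟨gpoly_mem_span n hkm (by omega) hK,
    leadPair_gpoly hkm (by omega) hK⟩, fun g hg _ i j hij => ?_⟩
  by_cases hik : k ≤ i
  · exact Or.inl hik
  obtain ⟨a, w, hw, rfl⟩ := Ideal.mem_span_insert.1 hg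
  obtain ⟨b, c, rfl⟩ := Ideal.mem_span_pair.1 hw
  obtain ⟨hdeg, hne, hj⟩ := hij.natDegree_toBivariate
  have himage : toBivariate K (a * X 0 ^ m + (b * X 1 ^ n + c * (X 0 + X 1) ^ k)) =
      Polynomial.X ^ m * toBivariate K a + Polynomial.C Polynomial.X ^ n * toBivariate K b +
        (Polynomial.X + Polynomial.C Polynomial.X) ^ k * toBivariate K c := by
    simp only [map_add, map_mul, map_pow, toBivariate_X_zero, toBivariate_X_one]
    ring
  rw [himage] at hdeg hne hj
  have hle := Polynomial.natDegree_le_of_dvd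
    (X_pow_dvd_coeff_of_natDegree_le hkm hK _ _ _ (by omega) hdeg) hne
  rw [Polynomial.natDegree_X_pow] at hle
  rcases min_le_iff.1 (hle.trans hj) with h | h
  · exact Or.inr (Or.inl h)
  · exact Or.inr (Or.inr ⟨k - 1 - i, by omega, by omega, h⟩)
end

section
/- Let k, a, v be integers with 0 ≤ a ≤ k and a + v ≥ 0. Let D be the (a+v+1) × (a+v+1) matrix over ℚ with entries D_{i,j} = C(k, a−i+j) for 0 ≤ i, j ≤ a+v, where C(k,ℓ) is defined to be 0 when ℓ < 0 or ℓ > k. Then det D = ( ∏_{i=0}^{a+v} C(k+i, a+i) ) / ( ∏_{i=0}^{a+v} C(k+v−i, a+v−i) ); here every binomial coefficient appearing in the formula is a nonzero positive integer. -/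
open Finset

/-- Vandermonde's identity, summed over any range that contains the support of `Nat.choose i`. -/
lemma sum_range_choose_mul_ite_choose {i M : ℕ} (hM : i < M) (k n : ℕ) :
    ∑ m ∈ range M, (i.choose m : ℚ) * (if m ≤ n then (k.choose (n - m) : ℚ) else 0)
      = ((i + k).choose n : ℚ) := by
  have hleft : ∑ m ∈ range M, (i.choose m : ℚ) * (if m ≤ n then (k.choose (n - m) : ℚ) else 0)
      = ∑ m ∈ range (M + (n + 1)),
        (i.choose m : ℚ) * (if m ≤ n then (k.choose (n - m) : ℚ) else 0) := by
    refine sum_subset (by intro m; simp only [mem_range]; omega) fun m _ hm => ?_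
    rw [Nat.choose_eq_zero_of_lt (by simp only [mem_range] at hm; omega)]
    simp
  have hright : ∑ m ∈ range (n + 1),
        (i.choose m : ℚ) * (if m ≤ n then (k.choose (n - m) : ℚ) else 0)
      = ∑ m ∈ range (M + (n + 1)),
        (i.choose m : ℚ) * (if m ≤ n then (k.choose (n - m) : ℚ) else 0) := by
    refine sum_subset (by intro m; simp only [mem_range]; omega) fun m _ hm => ?_
    rw [if_neg (by simp only [mem_range] at hm; omega), mul_zero]
  rw [hleft, ← hright, Nat.add_choose_eq, Nat.sum_antidiagonal_eq_sum_range_succ_mk]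
  push_cast
  refine sum_congr rfl fun m hm => ?_
  rw [if_pos (by simp only [mem_range] at hm; omega)]

/-- The matrix of binomial coefficients `C(i, m)` is lower unitriangular. -/
lemma det_choose_eq_one (n : ℕ) :
    (Matrix.of fun i m : Fin n => ((i : ℕ).choose m : ℚ)).det = 1 := by
  rw [Matrix.det_of_isLowerTriangular]
  · simp
  · intro i j hij
    have hlt : (i : ℕ) < j := hij
    simp [Nat.choose_eq_zero_of_lt hlt]

/-- The determinant of the matrix of falling factorials at consecutive integers. -/
lemma det_descFactorial_add (b n : ℕ) :
    (Matrix.of fun i j : Fin n => ((b + i : ℕ).descFactorial j : ℚ)).det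
      = ∏ i ∈ range n, (i.factorial : ℚ) := by
  have hpoly := Matrix.det_eval_matrixOfPolynomials_eq_det_vandermonde
    (fun i : Fin n => ((i : ℕ) : ℚ) + b) (fun j => descPochhammer ℚ j)
    (fun j => descPochhammer_natDegree ℚ j) (fun j => monic_descPochhammer ℚ j)
  rw [Matrix.det_vandermonde_add] at hpoly
  have hentry : (Matrix.of fun i j : Fin n => ((b + i : ℕ).descFactorial j : ℚ))
      = Matrix.of fun i j : Fin n => (descPochhammer ℚ j).eval (((i : ℕ) : ℚ) + b) := by
    ext i j
    simp only [Matrix.of_apply]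
    rw [← descPochhammer_eval_eq_descFactorial ℚ, Nat.cast_add, add_comm]
  rw [hentry, ← hpoly]
  cases n with
  | zero => simp
  | succ n =>
    rw [Matrix.det_vandermonde_id_eq_superFactorial, ← Nat.prod_range_succ_factorial]
    push_cast
    rfl

lemma cast_choose_add_eq_mul_descFactorial (a b i j : ℕ) :
    ((i + (a + b)).choose (a + j) : ℚ)
      = (((a + b + i).factorial : ℚ) / (b + i).factorial) *
        ((1 / ((a + j).factorial : ℚ)) * ((b + i).descFactorial j : ℚ)) := by
  rcases le_or_gt j (b + i) with h | h
  · rw [Nat.cast_choose ℚ (by omega), show i + (a + b) - (a + j) = b + i - j by omega,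
      show i + (a + b) = a + b + i by omega, ← Nat.factorial_mul_descFactorial h]
    have hd : (b + i).descFactorial j ≠ 0 := by
      rw [Ne, Nat.descFactorial_eq_zero_iff_lt]; omega
    push_cast
    field_simp
  · rw [Nat.choose_eq_zero_of_lt (by omega), Nat.descFactorial_eq_zero_iff_lt.2 h]
    simp

/-- The determinant of the Toeplitz matrix of the binomial coefficients `C(a + b, a - i + j)`. -/
lemma det_toeplitz_choose (a b n : ℕ) :
    (Matrix.of fun i j : Fin n =>
        if (i : ℕ) ≤ a + j then ((a + b).choose (a + j - i) : ℚ) else 0).det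
      = ∏ i ∈ range n, ((a + b + i).factorial : ℚ) * i.factorial /
          ((a + i).factorial * (b + i).factorial) := by
  have hmul : (Matrix.of fun i m : Fin n => ((i : ℕ).choose m : ℚ)) *
      (Matrix.of fun i j : Fin n =>
        if (i : ℕ) ≤ a + j then ((a + b).choose (a + j - i) : ℚ) else 0)
      = Matrix.of fun i j : Fin n => (((a + b + i).factorial : ℚ) / (b + i).factorial) *
          (Matrix.of fun i j : Fin n => (1 / ((a + j).factorial : ℚ)) *
            (Matrix.of fun i j : Fin n => ((b + i : ℕ).descFactorial j : ℚ)) i j) i j := by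
    ext i j
    simp only [Matrix.mul_apply, Matrix.of_apply]
    rw [← cast_choose_add_eq_mul_descFactorial, ← sum_range_choose_mul_ite_choose i.isLt,
      ← Fin.sum_univ_eq_sum_range (fun m => ((i : ℕ).choose m : ℚ) *
        (if m ≤ a + j then ((a + b).choose (a + j - m) : ℚ) else 0))]
  have hdet := congrArg Matrix.det hmul
  rw [Matrix.det_mul, det_choose_eq_one, one_mul, Matrix.det_mul_column, Matrix.det_mul_row,
    det_descFactorial_add,
    Fin.prod_univ_eq_prod_range (fun i => ((a + b + i).factorial : ℚ) / (b + i).factorial),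
    Fin.prod_univ_eq_prod_range (fun j => 1 / ((a + j).factorial : ℚ)),
    ← prod_mul_distrib, ← prod_mul_distrib] at hdet
  rw [hdet]
  refine prod_congr rfl fun i _ => ?_
  field_simp

/-- The determinant of the binomial-coefficient matrix `D(k,a,v)` over `ℚ`
(Lemma on generalized determinants). -/
theorem stmt4 (k a : ℕ) (v : ℤ) (hak : a ≤ k) (hav : 0 ≤ (a : ℤ) + v)
    (N : ℕ) (hN : (N : ℤ) = (a : ℤ) + v) :
    Matrix.det (Matrix.of (fun i j : Fin (N + 1) =>
        if 0 ≤ (a : ℤ) - (i : ℤ) + (j : ℤ) then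
          ((Nat.choose k ((a : ℤ) - (i : ℤ) + (j : ℤ)).toNat : ℚ))
        else 0))
      = (∏ i ∈ Finset.range (N + 1), (Nat.choose (k + i) (a + i) : ℚ)) /
        (∏ i ∈ Finset.range (N + 1), (Nat.choose (k - a + (N - i)) (N - i) : ℚ)) ∧
    (∀ i ≤ N, 0 < Nat.choose (k + i) (a + i) ∧ 0 < Nat.choose (k - a + (N - i)) (N - i)) := by
  refine ⟨?_, fun i hi => ⟨Nat.choose_pos (by omega), Nat.choose_pos (by omega)⟩⟩
  obtain ⟨b, rfl⟩ := Nat.exists_eq_add_of_le hak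
  have hmat : (Matrix.of (fun i j : Fin (N + 1) =>
        if 0 ≤ (a : ℤ) - (i : ℤ) + (j : ℤ) then
          ((Nat.choose (a + b) ((a : ℤ) - (i : ℤ) + (j : ℤ)).toNat : ℚ))
        else 0))
      = Matrix.of fun i j : Fin (N + 1) =>
        if (i : ℕ) ≤ a + j then ((a + b).choose (a + j - i) : ℚ) else 0 := by
    ext i j
    simp only [Matrix.of_apply]
    rw [show ((a : ℤ) - (i : ℤ) + (j : ℤ)).toNat = a + j - i by omega]
    exact if_congr (by omega) rfl rfl
  have hrefl := prod_range_reflect (fun i => ((b + i).choose i : ℚ)) (N + 1)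
  simp only [Nat.add_sub_cancel] at hrefl
  rw [hmat, det_toeplitz_choose, Nat.add_sub_cancel_left, hrefl, ← prod_div_distrib]
  refine prod_congr rfl fun i _ => ?_
  rw [Nat.cast_choose ℚ (show a + i ≤ a + b + i by omega),
    Nat.cast_choose ℚ (show i ≤ b + i by omega),
    show a + b + i - (a + i) = b by omega, Nat.add_sub_cancel]
  field_simp
end

section
/- Let K be a field and let α, β, η be nonnegative integers with α ≥ β. In K[x,y] consider the monomial ideal J = (x^β, y^η) + ( x^{β−1−t} y^{α−β+1+2t} : 0 ≤ t ≤ β−1 ). Then the K-vector space dimension ℓ = dim_K K[x,y]/J is finite and is given as follows: (a) if β + η ≤ α, then ℓ = β·η; (b) if α + β ≤ η, then ℓ = β·α; (c) if β + η > α and α + β > η, then ℓ = β·η − ⌊(β+η−α)²/4⌋. -/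
open MvPolynomial Finset

/-- The monomial ideal `J = (x^β, y^η) + (x^{β-1-t} y^{α-β+1+2t} : 0 ≤ t ≤ β-1)`. -/
noncomputable def Jideal (K : Type*) [Field K] (α β η : ℕ) : Ideal (MvPolynomial (Fin 2) K) :=
  Ideal.span (({X 0 ^ β, X 1 ^ η} : Set (MvPolynomial (Fin 2) K)) ∪
    {q | ∃ t : ℕ, t < β ∧ q = X 0 ^ (β - 1 - t) * X 1 ^ (α - β + 1 + 2 * t)})

/-- The quotient by a monomial ideal has the standard monomials as a basis: taking their
coefficients is a linear equivalence. -/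
theorem exists_linearEquiv_quotient_span_monomial {σ K : Type*} [Field K] (S : Set (σ →₀ ℕ))
    (T : Finset (σ →₀ ℕ)) (hT : ∀ m, m ∈ T ↔ ∀ s ∈ S, ¬ s ≤ m) :
    Nonempty ((MvPolynomial σ K ⧸
      Ideal.span ((fun s => monomial s (1 : K)) '' S)) ≃ₗ[K] (T → K)) := by
  classical
  set J := Ideal.span ((fun s => monomial s (1 : K)) '' S) with hJ
  let φ : MvPolynomial σ K →ₗ[K] (T → K) := LinearMap.pi fun t => lcoeff K (t : σ →₀ ℕ)
  have hφ : ∀ p t, φ p t = coeff (t : σ →₀ ℕ) p := fun _ _ => rfl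
  have hsurj : Function.Surjective φ := by
    intro f
    refine ⟨∑ t : T, monomial (t : σ →₀ ℕ) (f t), ?_⟩
    ext t
    simp [hφ, coeff_sum, coeff_monomial, Finset.sum_ite_eq']
  have hker : J.restrictScalars K = LinearMap.ker φ := by
    ext p
    rw [Submodule.restrictScalars_mem, hJ, mem_ideal_span_monomial_image, LinearMap.mem_ker]
    constructor
    · intro h
      ext t
      by_contra hne
      obtain ⟨s, hs, hst⟩ := h t (mem_support_iff.mpr hne)
      exact (hT t).mp t.2 s hs hst
    · intro h m hm
      by_contra! hcon
      exact mem_support_iff.mp hm (congrFun h ⟨m, (hT m).mpr hcon⟩)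
  exact ⟨(Submodule.Quotient.restrictScalarsEquiv K J).symm ≪≫ₗ
    Submodule.quotEquivOfEq _ _ hker ≪≫ₗ φ.quotKerEquivOfSurjective hsurj⟩

/-- The exponent vector of `x ^ a * y ^ b`. -/
noncomputable def exponentPair (a b : ℕ) : Fin 2 →₀ ℕ := Finsupp.single 0 a + Finsupp.single 1 b

@[simp] theorem exponentPair_zero (a b : ℕ) : exponentPair a b 0 = a := by simp [exponentPair]

@[simp] theorem exponentPair_one (a b : ℕ) : exponentPair a b 1 = b := by simp [exponentPair]

theorem exponentPair_le_iff (a b : ℕ) (m : Fin 2 →₀ ℕ) :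
    exponentPair a b ≤ m ↔ a ≤ m 0 ∧ b ≤ m 1 := by
  simp [Finsupp.le_def, Fin.forall_fin_two]

theorem monomial_exponentPair (K : Type*) [Field K] (a b : ℕ) :
    monomial (exponentPair a b) (1 : K) = X 0 ^ a * X 1 ^ b := by
  simp [exponentPair, X_pow_eq_monomial, monomial_mul]

/-- The exponents of the generators of `Jideal`. -/
def JidealExponents (α β η : ℕ) : Set (Fin 2 →₀ ℕ) :=
  {exponentPair β 0, exponentPair 0 η} ∪
    {m | ∃ t < β, m = exponentPair (β - 1 - t) (α - β + 1 + 2 * t)}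

theorem Jideal_eq_span_monomial (K : Type*) [Field K] (α β η : ℕ) :
    Jideal K α β η =
      Ideal.span ((fun s => monomial s (1 : K)) '' JidealExponents α β η) := by
  unfold Jideal JidealExponents
  congr 1
  rw [Set.image_union, Set.image_pair]
  congr 1
  · simp [monomial_exponentPair]
  · ext q
    constructor
    · rintro ⟨t, ht, rfl⟩
      exact ⟨_, ⟨t, ht, rfl⟩, monomial_exponentPair K _ _⟩
    · rintro ⟨_, ⟨t, ht, rfl⟩, rfl⟩
      exact ⟨t, ht, monomial_exponentPair K _ _⟩

/-- The exponents of the standard monomials of `Jideal`, column by column. -/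
noncomputable def standardExponents (α β η : ℕ) : Finset (Fin 2 →₀ ℕ) :=
  ((range β).sigma fun t => range (min η (α - β + 1 + 2 * t))).image
    fun p => exponentPair (β - 1 - p.1) p.2

theorem mem_standardExponents (α β η : ℕ) (m : Fin 2 →₀ ℕ) :
    m ∈ standardExponents α β η ↔ ∀ s ∈ JidealExponents α β η, ¬ s ≤ m := by
  simp only [standardExponents, JidealExponents, mem_image, mem_sigma, mem_range, Sigma.exists]
  constructor
  · rintro ⟨t, b, ⟨ht, hb⟩, rfl⟩ s ((rfl | rfl) | ⟨u, hu, rfl⟩) hle <;>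
      simp only [exponentPair_le_iff, exponentPair_zero, exponentPair_one] at hle <;> omega
  · intro h
    have hx := h _ (Or.inl (Or.inl rfl))
    have hy := h _ (Or.inl (Or.inr rfl))
    rw [exponentPair_le_iff] at hx hy
    have hxy := h _ (Or.inr ⟨β - 1 - m 0, by omega, rfl⟩)
    rw [exponentPair_le_iff] at hxy
    refine ⟨β - 1 - m 0, m 1, by omega, ?_⟩
    ext i
    fin_cases i
    · simp; omega
    · simp

theorem card_standardExponents (α β η : ℕ) :
    (standardExponents α β η).card = ∑ t ∈ range β, min η (α - β + 1 + 2 * t) := by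
  rw [standardExponents, card_image_of_injOn, card_sigma]
  · simp
  · rintro ⟨t, b⟩ ht ⟨u, c⟩ hu h
    have h0 := DFunLike.congr_fun h 0
    have h1 := DFunLike.congr_fun h 1
    simp only [coe_sigma, Set.mem_sigma_iff, mem_coe, mem_range, exponentPair_zero,
      exponentPair_one] at ht hu h0 h1
    obtain rfl : t = u := by omega
    rw [h1]

theorem sum_range_add_one_add_two_mul (c n : ℕ) :
    ∑ t ∈ range n, (c + 1 + 2 * t) = n * (c + n) := by
  induction n with
  | zero => simp
  | succ n ih => rw [sum_range_succ, ih]; ring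

/-- A sum of steps of size two truncated at `c + k`; the first `k / 2` terms are below the bound. -/
theorem sum_range_min_add_one_add_two_mul (c k n : ℕ) (hk : k ≤ 2 * n) :
    (∑ t ∈ range n, min (c + k) (c + 1 + 2 * t) : ℕ) + k ^ 2 / 4 = n * (c + k) := by
  obtain ⟨r, rfl⟩ : ∃ r, n = k / 2 + r := ⟨n - k / 2, by omega⟩
  rw [sum_range_add, sum_congr rfl (g := fun t => c + 1 + 2 * t),
    sum_range_add_one_add_two_mul, sum_congr rfl (g := fun _ => c + k)]
  · rw [sum_const, card_range, smul_eq_mul]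
    obtain ⟨j, rfl | rfl⟩ := k.even_or_odd'
    · have h : (2 * j) ^ 2 / 4 = j ^ 2 := by
        rw [show (2 * j) ^ 2 = 4 * j ^ 2 by ring]; omega
      rw [h, show 2 * j / 2 = j by omega]
      ring
    · have h : (2 * j + 1) ^ 2 / 4 = j ^ 2 + j := by
        rw [show (2 * j + 1) ^ 2 = 4 * (j ^ 2 + j) + 1 by ring]; omega
      rw [h, show (2 * j + 1) / 2 = j by omega]
      ring
  · intro t _
    omega
  · intro t ht
    rw [mem_range] at ht
    omega

/-- Colength of the monomial ideal `J` (Lemma on lengths of the staircase monomial ideals). -/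
theorem stmt6 (K : Type*) [Field K] (α β η : ℕ) (hba : β ≤ α) :
    FiniteDimensional K (MvPolynomial (Fin 2) K ⧸ Jideal K α β η) ∧
    (β + η ≤ α →
      Module.finrank K (MvPolynomial (Fin 2) K ⧸ Jideal K α β η) = β * η) ∧
    (α + β ≤ η →
      Module.finrank K (MvPolynomial (Fin 2) K ⧸ Jideal K α β η) = β * α) ∧
    (α < β + η → η < α + β →
      (Module.finrank K (MvPolynomial (Fin 2) K ⧸ Jideal K α β η) : ℤ)
        = (β : ℤ) * η - ((β : ℤ) + η - α) ^ 2 / 4) := by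
  obtain ⟨e⟩ := exists_linearEquiv_quotient_span_monomial (K := K) (JidealExponents α β η)
    (standardExponents α β η) (mem_standardExponents α β η)
  rw [← Jideal_eq_span_monomial] at e
  have hrank : Module.finrank K (MvPolynomial (Fin 2) K ⧸ Jideal K α β η) =
      ∑ t ∈ range β, min η (α - β + 1 + 2 * t) := by
    rw [e.finrank_eq, Module.finrank_fintype_fun_eq_card, Fintype.card_coe,
      card_standardExponents]
  rw [hrank]
  obtain ⟨c, rfl⟩ := Nat.exists_eq_add_of_le' hba
  rw [Nat.add_sub_cancel]
  refine ⟨Module.Finite.equiv e.symm, fun h => ?_, fun h => ?_, fun h₁ h₂ => ?_⟩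
  · rw [sum_congr rfl (g := fun _ => η) fun t _ => by omega]
    simp
  · rw [sum_congr rfl (g := fun t => c + 1 + 2 * t) fun t ht => by rw [mem_range] at ht; omega,
      sum_range_add_one_add_two_mul]
  · obtain ⟨k, rfl⟩ : ∃ k, η = c + k := ⟨η - c, by omega⟩
    have h := sum_range_min_add_one_add_two_mul c k β (by omega)
    have hk : (β : ℤ) + ((c + k : ℕ) : ℤ) - ((c + β : ℕ) : ℤ) = k := by push_cast; ring
    rw [hk]
    have h' := congrArg (Nat.cast : ℕ → ℤ) h
    rw [Nat.cast_add, Nat.cast_mul, Int.natCast_ediv] at h'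
    push_cast at h' ⊢
    linarith
end

section
/- Let K be a field and let m, n, k be nonnegative integers. Assume either that K has characteristic 0, or that K has characteristic p for a prime p with min(m+k, m+n, n+k) ≤ p. Let ℓ_{k,m,n} = dim_K K[x,y]/(x^m, y^n, (x+y)^k). Then: (a) if n ≥ k + m, then ℓ_{k,m,n} = k·m; (b) if k ≥ m + n, then ℓ_{k,m,n} = m·n; (c) if m ≥ n + k, then ℓ_{k,m,n} = k·n; (d) if k + m > n and m + n > k and n + k > m, then ℓ_{k,m,n} = k·n + k·m + n·m − ⌊(k+n+m)²/4⌋. -/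
open MvPolynomial

/-- The ideal `(x^m, y^n, (x+y)^k)` of `K[x,y]`. -/
noncomputable def Ikmn (K : Type*) [Field K] (k m n : ℕ) : Ideal (MvPolynomial (Fin 2) K) :=
  Ideal.span ({X 0 ^ m, X 1 ^ n, (X 0 + X 1) ^ k} : Set (MvPolynomial (Fin 2) K))

open scoped Polynomial

section DegreewiseRelations

variable {K : Type*} [Field K]

/-- A polynomial whose degree is small compared with the characteristic and whose `b`-th derivative
vanishes has degree less than `b`. -/
theorem degree_lt_of_iterate_derivative_eq_zero {e b : ℕ} {P : K[X]}
    (hK : ∀ i < e, (i.factorial : K) ≠ 0) (hP : P.degree < e)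
    (hd : Polynomial.derivative^[b] P = 0) : P.degree < b := by
  rw [Polynomial.degree_lt_iff_coeff_zero]
  intro i hi
  by_cases hie : i < e
  · have h := congrArg (fun Q => Q.coeff (i - b)) hd
    simp only [Polynomial.coeff_iterate_derivative, Polynomial.coeff_zero,
      Nat.sub_add_cancel hi, nsmul_eq_mul, mul_eq_zero] at h
    refine h.resolve_left fun h0 => hK i hie ?_
    rw [← Nat.factorial_mul_descFactorial hi, Nat.cast_mul, h0, mul_zero]
  · exact (Polynomial.degree_lt_iff_coeff_zero _ _).1 hP i (not_lt.1 hie)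

theorem isCoprime_X_X_add_one :
    IsCoprime (Polynomial.X : K[X]) (Polynomial.X + 1) :=
  ⟨-1, 1, by ring⟩

theorem eq_zero_of_pow_dvd_of_degree_lt {P q : K[X]} {m b : ℕ} (hq : q.natDegree = 1)
    (hdvd : q ^ m ∣ P) (hP : P.degree < b) (hbm : b ≤ m) : P = 0 := by
  have hq0 : q ≠ 0 := by rintro rfl; simp at hq
  refine Polynomial.eq_zero_of_dvd_of_degree_lt hdvd (hP.trans_le ?_)
  rw [Polynomial.degree_pow, Polynomial.degree_eq_natDegree hq0, hq]
  simpa using hbm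

/-- Differentiating often enough to kill `G` shows that a low-degree relation between multiples of
`t ^ m`, `1` and `(t + 1) ^ k` is trivial. -/
theorem relation_trivial {e m n k : ℕ} (hK : ∀ i < e, (i.factorial : K) ≠ 0)
    (hsum : (e - m) + (e - n) + (e - k) ≤ e) {P G Q : K[X]}
    (hP : P.degree < e) (hQ : Q.degree < e) (hG : G.degree < (e - n : ℕ))
    (hmP : Polynomial.X ^ m ∣ P) (hkQ : (Polynomial.X + 1) ^ k ∣ Q)
    (h : P + G + Q = 0) : P = 0 ∧ G = 0 ∧ Q = 0 := by
  set b := e - n with hb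
  have hX1 : (Polynomial.X + 1 : K[X]).natDegree = 1 := by
    simpa using Polynomial.natDegree_X_add_C (1 : K)
  have hGd : Polynomial.derivative^[b] G = 0 := by
    by_cases hG0 : G = 0
    · simp [hG0]
    · exact Polynomial.iterate_derivative_eq_zero
        ((Polynomial.natDegree_lt_iff_degree_lt hG0).2 hG)
  have hPQ : Polynomial.derivative^[b] P = - Polynomial.derivative^[b] Q := by
    have := congrArg (Polynomial.derivative^[b]) h
    simp only [iterate_map_add, hGd, add_zero, iterate_map_zero] at this
    exact eq_neg_of_add_eq_zero_left this
  have hdvd : Polynomial.X ^ (m - b) * (Polynomial.X + 1) ^ (k - b) ∣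
      Polynomial.derivative^[b] P := by
    refine (isCoprime_X_X_add_one.pow).mul_dvd
      (Polynomial.pow_sub_dvd_iterate_derivative_of_pow_dvd b hmP) ?_
    rw [hPQ, dvd_neg]
    exact Polynomial.pow_sub_dvd_iterate_derivative_of_pow_dvd b hkQ
  have hPd : Polynomial.derivative^[b] P = 0 := by
    by_cases hP0 : P = 0
    · simp [hP0]
    rcases lt_or_ge P.natDegree b with hPb | hPb
    · exact Polynomial.iterate_derivative_eq_zero hPb
    by_contra hne
    have h1 := Polynomial.natDegree_le_of_dvd hdvd hne
    have h2 := Polynomial.natDegree_iterate_derivative P b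
    have h3 := (Polynomial.natDegree_lt_iff_degree_lt hP0).2 hP
    rw [Polynomial.natDegree_mul (pow_ne_zero _ Polynomial.X_ne_zero)
      (pow_ne_zero _ (by rintro h0; simp [h0] at hX1)), Polynomial.natDegree_pow,
      Polynomial.natDegree_pow, hX1, Polynomial.natDegree_X] at h1
    omega
  have hQd : Polynomial.derivative^[b] Q = 0 := by
    rw [hPd] at hPQ
    exact neg_eq_zero.1 hPQ.symm
  have hP0 : P = 0 := eq_zero_of_pow_dvd_of_degree_lt Polynomial.natDegree_X hmP
    (degree_lt_of_iterate_derivative_eq_zero hK hP hPd) (by omega)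
  have hQ0 : Q = 0 := eq_zero_of_pow_dvd_of_degree_lt hX1 hkQ
    (degree_lt_of_iterate_derivative_eq_zero hK hQ hQd) (by omega)
  refine ⟨hP0, ?_, hQ0⟩
  simpa [hP0, hQ0] using h

variable (K) in
/-- The map `(f, g, h) ↦ t ^ m f + g + (t + 1) ^ k h` on triples of polynomials for which the three
summands are dehomogenizations of forms of degree `e - 1`. -/
noncomputable def relationMap (e m n k : ℕ) :
    (Polynomial.degreeLT K (e - m) × Polynomial.degreeLT K (e - n) × Polynomial.degreeLT K (e - k))
      →ₗ[K] K[X] :=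
  ((LinearMap.mulLeft K (Polynomial.X ^ m)).comp (Polynomial.degreeLT K (e - m)).subtype).coprod
    ((Polynomial.degreeLT K (e - n)).subtype.coprod
      ((LinearMap.mulLeft K ((Polynomial.X + 1) ^ k)).comp
        (Polynomial.degreeLT K (e - k)).subtype))

variable (K) in
/-- The dehomogenization of the degree `e - 1` part of `(x ^ m, y ^ n, (x + y) ^ k)`. -/
noncomputable def idealPart (e m n k : ℕ) : Submodule K K[X] :=
  LinearMap.range (relationMap K e m n k)

theorem mem_idealPart {e m n k : ℕ} {p : K[X]} :
    p ∈ idealPart K e m n k ↔ ∃ f ∈ Polynomial.degreeLT K (e - m),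
      ∃ g ∈ Polynomial.degreeLT K (e - n), ∃ h ∈ Polynomial.degreeLT K (e - k),
        Polynomial.X ^ m * f + g + (Polynomial.X + 1) ^ k * h = p := by
  simp [idealPart, relationMap, add_assoc]

theorem mul_mem_degreeLT {e m : ℕ} {q f : K[X]} (hq : q.natDegree ≤ m)
    (hf : f ∈ Polynomial.degreeLT K (e - m)) : q * f ∈ Polynomial.degreeLT K e := by
  rw [Polynomial.mem_degreeLT] at hf ⊢
  by_cases h0 : q * f = 0
  · simp [h0, bot_lt_iff_ne_bot]
  have hf0 : f ≠ 0 := right_ne_zero_of_mul h0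
  rw [← Polynomial.natDegree_lt_iff_degree_lt hf0] at hf
  rw [← Polynomial.natDegree_lt_iff_degree_lt h0]
  have := Polynomial.natDegree_mul_le (p := q) (q := f)
  omega

theorem natDegree_X_add_one_pow_le (k : ℕ) :
    ((Polynomial.X + 1 : K[X]) ^ k).natDegree ≤ k := by
  refine Polynomial.natDegree_pow_le.trans ?_
  simpa using Nat.mul_le_mul_left k (Polynomial.natDegree_X_add_C (1 : K)).le

theorem idealPart_le_degreeLT (e m n k : ℕ) :
    idealPart K e m n k ≤ Polynomial.degreeLT K e := by
  intro p hp
  obtain ⟨f, hf, g, hg, h, hh, rfl⟩ := mem_idealPart.1 hp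
  exact add_mem (add_mem (mul_mem_degreeLT (Polynomial.natDegree_X_pow_le m) hf)
    (Polynomial.degreeLT_mono (Nat.sub_le _ _) hg))
    (mul_mem_degreeLT (natDegree_X_add_one_pow_le k) hh)

instance finite_degreeLT (e : ℕ) : Module.Finite K (Polynomial.degreeLT K e) :=
  Module.Finite.equiv (Polynomial.degreeLTEquiv K e).symm

theorem finrank_degreeLT_eq (e : ℕ) : Module.finrank K (Polynomial.degreeLT K e) = e := by
  simp [(Polynomial.degreeLTEquiv K e).finrank_eq]

theorem relationMap_injective {e m n k : ℕ} (hK : ∀ i < e, (i.factorial : K) ≠ 0)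
    (hsum : (e - m) + (e - n) + (e - k) ≤ e) :
    Function.Injective (relationMap K e m n k) := by
  rw [← LinearMap.ker_eq_bot, LinearMap.ker_eq_bot']
  rintro ⟨⟨f, hf⟩, ⟨g, hg⟩, ⟨h, hh⟩⟩ h0
  have h0' : Polynomial.X ^ m * f + g + (Polynomial.X + 1) ^ k * h = 0 := by
    simpa [relationMap, add_assoc] using h0
  obtain ⟨hf0, hg0, hh0⟩ := relation_trivial hK hsum
    (Polynomial.mem_degreeLT.1 (mul_mem_degreeLT (Polynomial.natDegree_X_pow_le m) hf))
    (Polynomial.mem_degreeLT.1 (mul_mem_degreeLT (natDegree_X_add_one_pow_le k) hh))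
    (Polynomial.mem_degreeLT.1 hg) (dvd_mul_right _ _) (dvd_mul_right _ _) h0'
  have hX1 : (Polynomial.X + 1 : K[X]) ≠ 0 := by simpa using Polynomial.X_add_C_ne_zero (1 : K)
  have hf' := (mul_eq_zero.1 hf0).resolve_left (pow_ne_zero _ Polynomial.X_ne_zero)
  have hh' := (mul_eq_zero.1 hh0).resolve_left (pow_ne_zero _ hX1)
  subst hf' hg0 hh'
  rfl

theorem finrank_idealPart_of_le {e m n k : ℕ} (hK : ∀ i < e, (i.factorial : K) ≠ 0)
    (hsum : (e - m) + (e - n) + (e - k) ≤ e) :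
    Module.finrank K (idealPart K e m n k) = (e - m) + (e - n) + (e - k) := by
  rw [idealPart, LinearMap.finrank_range_of_inj (relationMap_injective hK hsum)]
  simp [finrank_degreeLT_eq, add_assoc]

theorem idealPart_anti {e m n k k' : ℕ} (hk : k ≤ k') :
    idealPart K e m n k' ≤ idealPart K e m n k := by
  intro p hp
  obtain ⟨f, hf, g, hg, h, hh, rfl⟩ := mem_idealPart.1 hp
  refine mem_idealPart.2 ⟨f, hf, g, hg, (Polynomial.X + 1) ^ (k' - k) * h, ?_, ?_⟩
  · refine mul_mem_degreeLT (natDegree_X_add_one_pow_le (k' - k)) ?_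
    rwa [Nat.sub_sub, Nat.add_sub_cancel' hk]
  · rw [← mul_assoc, ← pow_add, Nat.add_sub_cancel' hk]

theorem idealPart_eq_degreeLT {e m n k : ℕ} (hK : ∀ i < e, (i.factorial : K) ≠ 0)
    (hemn : e ≤ m + n) (hsum : e ≤ (e - m) + (e - n) + (e - k)) :
    idealPart K e m n k = Polynomial.degreeLT K e := by
  refine le_antisymm (idealPart_le_degreeLT e m n k) ?_
  set k' := max k ((e - m) + (e - n))
  have hs : (e - m) + (e - n) + (e - k') = e := by omega
  refine le_trans (ge_of_eq ?_) (idealPart_anti (le_max_left k ((e - m) + (e - n))))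
  refine Submodule.eq_of_le_of_finrank_eq (idealPart_le_degreeLT e m n k') ?_
  rw [finrank_idealPart_of_le hK hs.le, hs, finrank_degreeLT_eq]

theorem finrank_quotient_idealPart {e m n k : ℕ} (hK : ∀ i < e, (i.factorial : K) ≠ 0)
    (hemn : e ≤ m + n) :
    Module.finrank K (Polynomial.degreeLT K e ⧸
        (idealPart K e m n k).comap (Polynomial.degreeLT K e).subtype) =
      e - ((e - m) + (e - n) + (e - k)) := by
  have h1 := Submodule.finrank_quotient_add_finrank
    ((idealPart K e m n k).comap (Polynomial.degreeLT K e).subtype)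
  rw [(Submodule.comapSubtypeEquivOfLe (idealPart_le_degreeLT e m n k)).finrank_eq,
    finrank_degreeLT_eq] at h1
  rcases le_total ((e - m) + (e - n) + (e - k)) e with hs | hs
  · rw [finrank_idealPart_of_le hK hs] at h1
    omega
  · have h2 := finrank_degreeLT_eq (K := K) e
    rw [← idealPart_eq_degreeLT hK hemn hs] at h2
    omega

end DegreewiseRelations

section Dehomogenization

variable {K : Type*} [Field K]

variable (K) in
/-- The substitution `x ↦ t s`, `y ↦ s`; the coefficient of `s ^ D` in the image of `f` is the
dehomogenization of the degree `D` component of `f`. -/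
noncomputable def dehomogenize : MvPolynomial (Fin 2) K →ₐ[K] K[X][X] :=
  aeval ![Polynomial.C Polynomial.X * Polynomial.X, Polynomial.X]

@[simp]
theorem dehomogenize_X_zero :
    dehomogenize K (X 0) = Polynomial.C Polynomial.X * Polynomial.X := by
  simp [dehomogenize]

@[simp]
theorem dehomogenize_X_one : dehomogenize K (X 1) = Polynomial.X := by
  simp [dehomogenize]

@[simp]
theorem dehomogenize_C (a : K) :
    dehomogenize K (C a) = Polynomial.C (Polynomial.C a) := by
  simp only [dehomogenize, algHom_C]
  rfl

theorem coeff_dehomogenize_mem_degreeLT (f : MvPolynomial (Fin 2) K) (D : ℕ) :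
    (dehomogenize K f).coeff D ∈ Polynomial.degreeLT K (D + 1) := by
  induction f using MvPolynomial.induction_on generalizing D with
  | C a =>
    rw [dehomogenize_C, Polynomial.coeff_C]
    split_ifs
    · refine Polynomial.mem_degreeLT.2 (Polynomial.degree_C_le.trans_lt ?_)
      exact_mod_cast Nat.succ_pos D
    · exact zero_mem _
  | add p q hp hq =>
    rw [map_add, Polynomial.coeff_add]
    exact add_mem (hp D) (hq D)
  | mul_X p i hp =>
    rw [map_mul]
    cases D with
    | zero => fin_cases i <;> simp
    | succ D =>
      fin_cases i
      · simp only [Fin.zero_eta, dehomogenize_X_zero, ← mul_assoc, Polynomial.coeff_mul_X,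
          Polynomial.coeff_mul_C]
        rw [mul_comm]
        exact mul_mem_degreeLT Polynomial.natDegree_X_le (by simpa using hp D)
      · simp only [Fin.mk_one, dehomogenize_X_one, Polynomial.coeff_mul_X]
        exact Polynomial.degreeLT_mono (Nat.le_succ _) (hp D)

theorem coeff_coeff_dehomogenize (f : MvPolynomial (Fin 2) K) (s : Fin 2 →₀ ℕ) :
    ((dehomogenize K f).coeff (s 0 + s 1)).coeff (s 0) = f.coeff s := by
  induction f using MvPolynomial.induction_on' with
  | monomial u a =>
    have hu : dehomogenize K (monomial u a) =
        Polynomial.C (Polynomial.C a * Polynomial.X ^ (u 0)) * Polynomial.X ^ (u 0 + u 1) := by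
      rw [monomial_eq, Finsupp.prod_fintype _ _ (by simp)]
      simp only [Fin.prod_univ_two, map_mul, map_pow, dehomogenize_C, dehomogenize_X_zero,
        dehomogenize_X_one]
      ring
    have hus : u = s ↔ u 0 = s 0 ∧ u 1 = s 1 := by
      simp [Finsupp.ext_iff, Fin.forall_fin_two]
    rw [hu, Polynomial.coeff_C_mul_X_pow, coeff_monomial]
    by_cases h0 : u 0 = s 0
    · by_cases h1 : u 1 = s 1
      · simp [hus, h0, h1]
      · simp [hus, h0, h1, Ne.symm h1]
    · split_ifs <;> simp_all [Polynomial.coeff_X_pow, eq_comm]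
  | add p q hp hq => simp [hp, hq]

theorem dehomogenize_injective : Function.Injective (dehomogenize K) := by
  intro f g h
  ext s
  rw [← coeff_coeff_dehomogenize, h, coeff_coeff_dehomogenize]

/-- Homogenization of a polynomial of degree at most `D` to a form of degree `D`. -/
noncomputable def homogenize (D : ℕ) (p : K[X]) : MvPolynomial (Fin 2) K :=
  ∑ i ∈ Finset.range (D + 1), C (p.coeff i) * (X 0 ^ i * X 1 ^ (D - i))

theorem dehomogenize_homogenize {D : ℕ} {p : K[X]} (hp : p ∈ Polynomial.degreeLT K (D + 1)) :
    dehomogenize K (homogenize D p) = Polynomial.C p * Polynomial.X ^ D := by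
  have hsum : p = ∑ i ∈ Finset.range (D + 1), Polynomial.C (p.coeff i) * Polynomial.X ^ i := by
    by_cases hp0 : p = 0
    · simp [hp0]
    · exact p.as_sum_range_C_mul_X_pow'
        ((Polynomial.natDegree_lt_iff_degree_lt hp0).2 (Polynomial.mem_degreeLT.1 hp))
  conv_rhs => rw [hsum]
  rw [homogenize, map_sum, map_sum, Finset.sum_mul]
  refine Finset.sum_congr rfl fun i hi => ?_
  have hi' : i + (D - i) = D := Nat.add_sub_cancel' (Nat.lt_succ_iff.1 (Finset.mem_range.1 hi))
  simp only [map_mul, map_pow, dehomogenize_C, dehomogenize_X_zero, dehomogenize_X_one]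
  conv_rhs => rw [← hi', pow_add]
  ring

theorem sum_homogenize_dehomogenize (f : MvPolynomial (Fin 2) K) :
    ∑ D ∈ (dehomogenize K f).support, homogenize D ((dehomogenize K f).coeff D) = f := by
  apply dehomogenize_injective
  rw [map_sum]
  conv_rhs => rw [(dehomogenize K f).as_sum_support_C_mul_X_pow]
  exact Finset.sum_congr rfl fun D _ =>
    dehomogenize_homogenize (coeff_dehomogenize_mem_degreeLT f D)

/-- If `q` is a form of degree `d` with dehomogenization `r`, then multiples of `r` homogenize to
multiples of `q`. -/
theorem dvd_homogenize_mul {D d : ℕ} {q : MvPolynomial (Fin 2) K} {r p : K[X]}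
    (hq : dehomogenize K q = Polynomial.C r * Polynomial.X ^ d) (hr : r.natDegree ≤ d)
    (hp : p ∈ Polynomial.degreeLT K (D + 1 - d)) : q ∣ homogenize D (r * p) := by
  by_cases hd : d ≤ D
  · refine ⟨homogenize (D - d) p, dehomogenize_injective ?_⟩
    rw [map_mul, hq, dehomogenize_homogenize (mul_mem_degreeLT hr hp),
      dehomogenize_homogenize (by rwa [← Nat.sub_add_comm hd])]
    conv_lhs => rw [← Nat.add_sub_cancel' hd, pow_add]
    rw [Polynomial.C_mul]
    ring
  · rw [Nat.sub_eq_zero_of_le (by omega)] at hp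
    have hp0 : p = 0 := by simpa [Polynomial.mem_degreeLT, Nat.WithBot.lt_zero_iff] using hp
    simp [hp0, homogenize]

/-- The degree `D` component of a multiple of a form of degree `d`. -/
theorem exists_coeff_dehomogenize_mul {D d : ℕ} {q : MvPolynomial (Fin 2) K} {r : K[X]}
    (hq : dehomogenize K q = Polynomial.C r * Polynomial.X ^ d) (f : MvPolynomial (Fin 2) K) :
    ∃ p ∈ Polynomial.degreeLT K (D + 1 - d), (dehomogenize K (f * q)).coeff D = r * p := by
  rw [map_mul, hq, mul_comm, mul_assoc, Polynomial.coeff_C_mul, Polynomial.coeff_X_pow_mul']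
  split_ifs with hd
  · refine ⟨_, ?_, rfl⟩
    rw [Nat.sub_add_comm hd]
    exact coeff_dehomogenize_mem_degreeLT f (D - d)
  · exact ⟨0, zero_mem _, rfl⟩

theorem dehomogenize_X_zero_pow (m : ℕ) :
    dehomogenize K (X 0 ^ m) = Polynomial.C (Polynomial.X ^ m) * Polynomial.X ^ m := by
  simp [mul_pow]

theorem dehomogenize_X_one_pow (n : ℕ) :
    dehomogenize K (X 1 ^ n) = Polynomial.C 1 * Polynomial.X ^ n := by
  simp

theorem dehomogenize_add_pow (k : ℕ) :
    dehomogenize K ((X 0 + X 1) ^ k) =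
      Polynomial.C ((Polynomial.X + 1) ^ k) * Polynomial.X ^ k := by
  rw [map_pow, Polynomial.C_pow, ← mul_pow]
  simp [add_mul]

theorem coeff_dehomogenize_mem_idealPart {k m n : ℕ} {f : MvPolynomial (Fin 2) K}
    (hf : f ∈ Ikmn K k m n) (D : ℕ) :
    (dehomogenize K f).coeff D ∈ idealPart K (D + 1) m n k := by
  obtain ⟨a, z, hz, rfl⟩ := Ideal.mem_span_insert.1 hf
  obtain ⟨b, c, rfl⟩ := Ideal.mem_span_pair.1 hz
  obtain ⟨p, hp, hap⟩ := exists_coeff_dehomogenize_mul (D := D) (dehomogenize_X_zero_pow m) a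
  obtain ⟨q, hq, hbq⟩ := exists_coeff_dehomogenize_mul (D := D) (dehomogenize_X_one_pow n) b
  obtain ⟨r, hr, hcr⟩ := exists_coeff_dehomogenize_mul (D := D) (dehomogenize_add_pow k) c
  refine mem_idealPart.2 ⟨p, hp, q, hq, r, hr, ?_⟩
  simp only [map_add, Polynomial.coeff_add, hap, hbq, hcr]
  ring

theorem homogenize_add (D : ℕ) (p q : K[X]) :
    homogenize D (p + q) = homogenize D p + homogenize D q := by
  simp [homogenize, add_mul, Finset.sum_add_distrib]

theorem homogenize_mem_of_mem_idealPart {k m n D : ℕ} {p : K[X]}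
    (hp : p ∈ idealPart K (D + 1) m n k) : homogenize D p ∈ Ikmn K k m n := by
  obtain ⟨f, hf, g, hg, h, hh, rfl⟩ := mem_idealPart.1 hp
  have hgen : ∀ q ∈ ({X 0 ^ m, X 1 ^ n, (X 0 + X 1) ^ k} : Set (MvPolynomial (Fin 2) K)),
      ∀ r, q ∣ r → r ∈ Ikmn K k m n :=
    fun q hq r hqr => Ideal.mem_of_dvd _ hqr (Ideal.subset_span hq)
  rw [homogenize_add, homogenize_add]
  refine add_mem (add_mem ?_ ?_) ?_
  · exact hgen (X 0 ^ m) (by simp) _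
      (dvd_homogenize_mul (dehomogenize_X_zero_pow m) (Polynomial.natDegree_X_pow_le m) hf)
  · rw [← one_mul g]
    exact hgen (X 1 ^ n) (by simp) _
      (dvd_homogenize_mul (dehomogenize_X_one_pow n) (by simp) hg)
  · exact hgen ((X 0 + X 1) ^ k) (by simp) _
      (dvd_homogenize_mul (dehomogenize_add_pow k) (natDegree_X_add_one_pow_le k) hh)

theorem homogenize_mem_of_le {k m n D : ℕ} (hD : m + n ≤ D) (p : K[X]) :
    homogenize D p ∈ Ikmn K k m n := by
  refine Ideal.sum_mem _ fun i _ => Ideal.mul_mem_left _ _ ?_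
  rcases le_total m i with hi | hi
  · exact Ideal.mul_mem_right _ _ (Ideal.mem_of_dvd _ (pow_dvd_pow _ hi)
      (Ideal.subset_span (by simp)))
  · exact Ideal.mul_mem_left _ _ (Ideal.mem_of_dvd _ (pow_dvd_pow _ (by omega : n ≤ D - i))
      (Ideal.subset_span (by simp)))

variable (K) in
/-- The degree `D` component of `K[x,y]/(x ^ m, y ^ n, (x + y) ^ k)`, dehomogenized. -/
def QuotientComponent (k m n D : ℕ) : Type _ :=
  Polynomial.degreeLT K (D + 1) ⧸
    (idealPart K (D + 1) m n k).comap (Polynomial.degreeLT K (D + 1)).subtype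

noncomputable instance (k m n D : ℕ) : AddCommGroup (QuotientComponent K k m n D) :=
  Submodule.Quotient.addCommGroup _

noncomputable instance (k m n D : ℕ) : Module K (QuotientComponent K k m n D) :=
  Submodule.Quotient.module _

instance (k m n D : ℕ) : Module.Finite K (QuotientComponent K k m n D) :=
  Module.Finite.quotient K _

variable (K) in
/-- The map sending a polynomial to the classes of its homogeneous components of degree less than
`m + n` modulo `(x ^ m, y ^ n, (x + y) ^ k)`. -/
noncomputable def componentMap (k m n : ℕ) : MvPolynomial (Fin 2) K →ₗ[K]
    (∀ D : Fin (m + n), QuotientComponent K k m n D) :=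
  LinearMap.pi fun D => (Submodule.mkQ (Submodule.comap _ (idealPart K (D + 1) m n k))).comp
    ((((Polynomial.lcoeff K[X] D).restrictScalars K).comp (dehomogenize K).toLinearMap).codRestrict
      (Polynomial.degreeLT K (D + 1)) fun f => coeff_dehomogenize_mem_degreeLT f D)

theorem componentMap_apply (k m n : ℕ) (f : MvPolynomial (Fin 2) K) (D : Fin (m + n)) :
    componentMap K k m n f D = Submodule.Quotient.mk
      ⟨(dehomogenize K f).coeff D, coeff_dehomogenize_mem_degreeLT f D⟩ :=
  rfl

theorem ker_componentMap (k m n : ℕ) :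
    LinearMap.ker (componentMap K k m n) = (Ikmn K k m n).restrictScalars K := by
  ext f
  have hker : f ∈ LinearMap.ker (componentMap K k m n) ↔
      ∀ D : Fin (m + n), (dehomogenize K f).coeff D ∈ idealPart K (D + 1) m n k := by
    rw [LinearMap.mem_ker, funext_iff]
    exact forall_congr' fun D => Submodule.Quotient.mk_eq_zero _
  rw [hker, Submodule.restrictScalars_mem]
  refine ⟨fun h => ?_, fun h D => coeff_dehomogenize_mem_idealPart h D⟩
  rw [← sum_homogenize_dehomogenize f]
  refine Ideal.sum_mem _ fun D _ => ?_
  rcases lt_or_ge D (m + n) with hD | hD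
  · exact homogenize_mem_of_mem_idealPart (h ⟨D, hD⟩)
  · exact homogenize_mem_of_le hD _

theorem componentMap_surjective (k m n : ℕ) :
    Function.Surjective (componentMap K k m n) := by
  intro v
  choose p hp using fun D => Submodule.Quotient.mk_surjective _ (v D)
  refine ⟨∑ D : Fin (m + n), homogenize D (p D : K[X]), funext fun D => ?_⟩
  rw [componentMap_apply, ← hp D]
  congr 1
  ext1
  simp only [map_sum, Polynomial.finsetSum_coeff]
  rw [Finset.sum_eq_single D]
  · rw [dehomogenize_homogenize (p D).2]
    simp
  · intro D' _ hne
    rw [dehomogenize_homogenize (p D').2, Polynomial.coeff_C_mul_X_pow,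
      if_neg fun h => hne (Fin.ext h.symm)]
  · simp

/-- `K[x,y]/(x ^ m, y ^ n, (x + y) ^ k)` decomposes into its homogeneous components. -/
theorem nonempty_quotient_equiv_pi (k m n : ℕ) :
    Nonempty ((MvPolynomial (Fin 2) K ⧸ Ikmn K k m n) ≃ₗ[K]
      (∀ D : Fin (m + n), QuotientComponent K k m n D)) :=
  ⟨(Submodule.Quotient.restrictScalarsEquiv K (Ikmn K k m n)).symm ≪≫ₗ
    Submodule.quotEquivOfEq _ _ (ker_componentMap k m n).symm ≪≫ₗ
    (componentMap K k m n).quotKerEquivOfSurjective (componentMap_surjective k m n)⟩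

theorem finiteDimensional_quotient (k m n : ℕ) :
    FiniteDimensional K (MvPolynomial (Fin 2) K ⧸ Ikmn K k m n) := by
  obtain ⟨e⟩ := nonempty_quotient_equiv_pi (K := K) k m n
  exact Module.Finite.equiv e.symm

theorem finrank_quotient_eq_sum (k m n : ℕ) (hK : ∀ i < m + n, (i.factorial : K) ≠ 0) :
    Module.finrank K (MvPolynomial (Fin 2) K ⧸ Ikmn K k m n) =
      ∑ e ∈ Finset.range (m + n + 1), (e - ((e - m) + (e - n) + (e - k))) := by
  obtain ⟨e⟩ := nonempty_quotient_equiv_pi (K := K) k m n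
  rw [e.finrank_eq, Module.finrank_pi_fintype, Finset.sum_range_succ', Finset.sum_range]
  simp only [Nat.zero_sub, add_zero]
  refine Finset.sum_congr rfl fun D _ => finrank_quotient_idealPart ?_ D.2
  exact fun i hi => hK i (hi.trans_le D.2)

end Dehomogenization

section Count

theorem two_mul_sum_range_sub (a q : ℕ) :
    2 * ∑ e ∈ Finset.range (q + 1), (e - a) = (q - a) * (q - a + 1) := by
  induction q with
  | zero => simp
  | succ q ih =>
    rw [Finset.sum_range_succ, mul_add, ih]
    rcases le_or_gt a q with h | h
    · rw [Nat.sub_add_comm h]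
      ring
    · rw [Nat.sub_eq_zero_of_le h.le, Nat.sub_eq_zero_of_le (by omega : q + 1 ≤ a)]

/-- As long as the three subtracted terms do not exceed `e`, the sum is a combination of
triangular numbers. -/
theorem two_mul_sum_range_add (k m n q : ℕ) (h : ∀ e ≤ q, (e - m) + (e - n) + (e - k) ≤ e) :
    2 * ∑ e ∈ Finset.range (q + 1), (e - ((e - m) + (e - n) + (e - k))) +
      ((q - m) * (q - m + 1) + (q - n) * (q - n + 1) + (q - k) * (q - k + 1)) = q * (q + 1) := by
  rw [← two_mul_sum_range_sub m, ← two_mul_sum_range_sub n, ← two_mul_sum_range_sub k, ← mul_add,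
    ← mul_add, ← mul_add, ← Finset.sum_add_distrib, ← Finset.sum_add_distrib,
    ← Finset.sum_add_distrib]
  have := two_mul_sum_range_sub 0 q
  rw [Nat.sub_zero] at this
  rw [← this]
  congr 1
  refine Finset.sum_congr rfl fun e he => ?_
  have := h e (Nat.lt_succ_iff.1 (Finset.mem_range.1 he))
  omega

theorem sum_eq_mul {k m n : ℕ} (h : m + n ≤ k) :
    ∑ e ∈ Finset.range (m + n + 1), (e - ((e - m) + (e - n) + (e - k))) = m * n := by
  have h1 := two_mul_sum_range_add k m n (m + n) fun e he => by omega
  rw [Nat.add_sub_cancel_left, Nat.add_sub_cancel, Nat.sub_eq_zero_of_le h] at h1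
  nlinarith

theorem sum_eq_of_triangle {k m n : ℕ} (hm : m ≤ k) (hn : n ≤ k) (h : k < m + n) :
    ((∑ e ∈ Finset.range (m + n + 1), (e - ((e - m) + (e - n) + (e - k))) : ℕ) : ℤ) =
      (k : ℤ) * n + (k : ℤ) * m + (n : ℤ) * m - ((k : ℤ) + n + m) ^ 2 / 4 := by
  obtain ⟨q, hq⟩ : ∃ q, q = (k + m + n) / 2 := ⟨_, rfl⟩
  have hsub : ∑ e ∈ Finset.range (m + n + 1), (e - ((e - m) + (e - n) + (e - k))) =
      ∑ e ∈ Finset.range (q + 1), (e - ((e - m) + (e - n) + (e - k))) := by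
    refine (Finset.sum_subset (Finset.range_mono (by omega)) fun e _ he => ?_).symm
    rw [Finset.mem_range] at he
    omega
  have h1 := two_mul_sum_range_add k m n q fun e he => by omega
  rw [hsub]
  generalize ∑ e ∈ Finset.range (q + 1), (e - ((e - m) + (e - n) + (e - k))) = S at h1 ⊢
  zify [(by omega : m ≤ q), (by omega : n ≤ q), (by omega : k ≤ q)] at h1
  rcases Nat.even_or_odd' (k + m + n) with ⟨c, hc | hc⟩
  · have hqc : q = c := by omega
    subst hqc
    have hs : (k : ℤ) + n + m = 2 * q := by exact_mod_cast (by omega : k + n + m = 2 * q)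
    have h4 : ((k : ℤ) + n + m) ^ 2 / 4 = q ^ 2 := by
      rw [hs, mul_pow]
      omega
    rw [h4]
    refine mul_left_cancel₀ (two_ne_zero (α := ℤ)) ?_
    linear_combination h1 + (1 - ((k : ℤ) + n + m)) * hs
  · have hqc : q = c := by omega
    subst hqc
    have hs : (k : ℤ) + n + m = 2 * q + 1 := by
      exact_mod_cast (by omega : k + n + m = 2 * q + 1)
    have h4 : ((k : ℤ) + n + m) ^ 2 / 4 = q ^ 2 + q := by
      rw [hs, show (2 * (q : ℤ) + 1) ^ 2 = 4 * (q ^ 2 + q) + 1 by ring]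
      omega
    rw [h4]
    refine mul_left_cancel₀ (two_ne_zero (α := ℤ)) ?_
    linear_combination h1 - ((k : ℤ) + n + m) * hs

end Count

section Symmetry

variable {K : Type*} [Field K]

theorem nonempty_quotient_equiv_of_involutive {k m n k' m' n' : ℕ}
    (φ : MvPolynomial (Fin 2) K →ₐ[K] MvPolynomial (Fin 2) K) (hφ : φ.comp φ = AlgHom.id K _)
    (h : (Ikmn K k m n).map (φ : MvPolynomial (Fin 2) K →+* MvPolynomial (Fin 2) K) =
      Ikmn K k' m' n') :
    Nonempty ((MvPolynomial (Fin 2) K ⧸ Ikmn K k m n) ≃ₗ[K]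
      (MvPolynomial (Fin 2) K ⧸ Ikmn K k' m' n')) :=
  ⟨(Ideal.quotientEquivAlg _ _ (AlgEquiv.ofAlgHom φ φ hφ hφ) h.symm).toLinearEquiv⟩

/-- Interchanging `x` and `y`. -/
theorem finrank_quotient_swap_last (k m n : ℕ) :
    Module.finrank K (MvPolynomial (Fin 2) K ⧸ Ikmn K k m n) =
      Module.finrank K (MvPolynomial (Fin 2) K ⧸ Ikmn K k n m) := by
  obtain ⟨e⟩ := nonempty_quotient_equiv_of_involutive (K := K) (k := k) (m := m) (n := n)
    (k' := k) (m' := n) (n' := m) (aeval ![X 1, X 0])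
    (by ext i : 1; fin_cases i <;> simp)
    (by
      rw [Ikmn, Ikmn, Ideal.map_span]
      simp only [Set.image_insert_eq, Set.image_singleton, RingHom.coe_coe, map_pow, map_add,
        aeval_X, Matrix.cons_val_zero, Matrix.cons_val_one]
      rw [Set.insert_comm, add_comm (X 1)])
  exact e.finrank_eq

/-- Interchanging `y` and `x + y` up to sign. -/
theorem finrank_quotient_swap_outer (k m n : ℕ) :
    Module.finrank K (MvPolynomial (Fin 2) K ⧸ Ikmn K k m n) =
      Module.finrank K (MvPolynomial (Fin 2) K ⧸ Ikmn K n m k) := by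
  obtain ⟨e⟩ := nonempty_quotient_equiv_of_involutive (K := K) (k := k) (m := m) (n := n)
    (k' := n) (m' := m) (n' := k) (aeval ![X 0, -(X 0 + X 1)])
    (by ext i : 1; fin_cases i <;> simp)
    (by
      rw [Ikmn, Ikmn, Ideal.map_span]
      simp only [Set.image_insert_eq, Set.image_singleton, RingHom.coe_coe, map_pow, map_add,
        aeval_X, Matrix.cons_val_zero, Matrix.cons_val_one]
      rw [show X 0 + -(X 0 + X 1) = -(X 1 : MvPolynomial (Fin 2) K) by ring,
        neg_pow, neg_pow (X 1 : MvPolynomial (Fin 2) K)]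
      simp only [Ideal.span_insert, Ideal.span_singleton_mul_left_unit
        ((isUnit_one.neg).pow _)]
      rw [sup_comm (Ideal.span {(X 0 + X 1) ^ n})])
  exact e.finrank_eq

end Symmetry

/-- The length formula when `k` is the largest of the three exponents. -/
theorem finrank_quotient_of_le {K : Type*} [Field K] {k m n : ℕ} (hm : m ≤ k) (hn : n ≤ k)
    (hK : ∀ i < m + n, (i.factorial : K) ≠ 0) :
    (m + n ≤ k → Module.finrank K (MvPolynomial (Fin 2) K ⧸ Ikmn K k m n) = m * n) ∧
    (k < m + n → (Module.finrank K (MvPolynomial (Fin 2) K ⧸ Ikmn K k m n) : ℤ)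
        = (k : ℤ) * n + (k : ℤ) * m + (n : ℤ) * m - ((k : ℤ) + n + m) ^ 2 / 4) := by
  rw [finrank_quotient_eq_sum k m n hK]
  exact ⟨sum_eq_mul, sum_eq_of_triangle hm hn⟩

theorem factorial_ne_zero_of_char {K : Type*} [Field K] {N : ℕ}
    (hchar : CharP K 0 ∨ ∃ p : ℕ, p.Prime ∧ CharP K p ∧ N ≤ p) {i : ℕ} (hi : i < N) :
    (i.factorial : K) ≠ 0 := by
  rcases hchar with h0 | ⟨p, hp, hKp, hNp⟩
  · have := CharP.charP_to_charZero K
    exact_mod_cast i.factorial_ne_zero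
  · rw [Ne, CharP.cast_eq_zero_iff K p, hp.dvd_factorial]
    omega

/-- The length `ℓ_{k,m,n}` of `K[x,y]/(x^m, y^n, (x+y)^k)` in characteristic `0`, or in
characteristic `p` with `min(m+k, m+n, n+k) ≤ p`. -/
theorem stmt7 (K : Type*) [Field K] (k m n : ℕ)
    (hchar : CharP K 0 ∨ ∃ p : ℕ, p.Prime ∧ CharP K p ∧ min (m + k) (min (m + n) (n + k)) ≤ p) :
    FiniteDimensional K (MvPolynomial (Fin 2) K ⧸ Ikmn K k m n) ∧
    (k + m ≤ n → Module.finrank K (MvPolynomial (Fin 2) K ⧸ Ikmn K k m n) = k * m) ∧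
    (m + n ≤ k → Module.finrank K (MvPolynomial (Fin 2) K ⧸ Ikmn K k m n) = m * n) ∧
    (n + k ≤ m → Module.finrank K (MvPolynomial (Fin 2) K ⧸ Ikmn K k m n) = k * n) ∧
    (n < k + m → k < m + n → m < n + k →
      (Module.finrank K (MvPolynomial (Fin 2) K ⧸ Ikmn K k m n) : ℤ)
        = (k : ℤ) * n + (k : ℤ) * m + (n : ℤ) * m - ((k : ℤ) + n + m) ^ 2 / 4) := by
  refine ⟨finiteDimensional_quotient k m n, ?_⟩
  have hK : ∀ i < min (m + k) (min (m + n) (n + k)), (i.factorial : K) ≠ 0 :=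
    fun i hi => factorial_ne_zero_of_char hchar hi
  rcases le_total m k with hmk | hmk
  · rcases le_total n k with hnk | hnk
    · obtain ⟨h1, h2⟩ := finrank_quotient_of_le (K := K) hmk hnk fun i hi => hK i (by omega)
      refine ⟨fun h => ?_, h1, fun h => ?_, fun _ h _ => h2 h⟩
      · obtain rfl : m = 0 := by omega
        simpa using h1 (by omega)
      · obtain rfl : n = 0 := by omega
        simpa using h1 (by omega)
    · obtain ⟨h1, h2⟩ := finrank_quotient_of_le (K := K) (hmk.trans hnk) hnk
        fun i hi => hK i (by omega)
      rw [finrank_quotient_swap_outer]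
      refine ⟨fun h => ?_, fun h => ?_, fun h => ?_, fun h _ _ => ?_⟩
      · rw [h1 (by omega), mul_comm]
      · obtain rfl : m = 0 := by omega
        simpa using h1 (by omega)
      · obtain rfl : k = 0 := by omega
        simpa using h1 (by omega)
      · rw [h2 (by omega)]
        ring_nf
  · rcases le_total n m with hnm | hnm
    · obtain ⟨h1, h2⟩ := finrank_quotient_of_le (K := K) hmk hnm fun i hi => hK i (by omega)
      rw [finrank_quotient_swap_last, finrank_quotient_swap_outer, finrank_quotient_swap_last]
      refine ⟨fun h => ?_, fun h => ?_, fun h => ?_, fun _ _ h => ?_⟩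
      · obtain rfl : k = 0 := by omega
        simpa using h1 (by omega)
      · obtain rfl : n = 0 := by omega
        simpa using h1 (by omega)
      · exact h1 (by omega)
      · rw [h2 (by omega)]
        ring_nf
    · obtain ⟨h1, h2⟩ := finrank_quotient_of_le (K := K) hnm (hmk.trans hnm)
        fun i hi => hK i (by omega)
      rw [finrank_quotient_swap_outer]
      refine ⟨fun h => ?_, fun h => ?_, fun h => ?_, fun h _ _ => ?_⟩
      · rw [h1 (by omega), mul_comm]
      · obtain rfl : m = 0 := by omega
        simpa using h1 (by omega)
      · obtain rfl : k = 0 := by omega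
        simpa using h1 (by omega)
      · rw [h2 (by omega)]
        ring_nf
end

section
/- Let K be a field, let g ∈ K[x,y] be any polynomial, and let m, n, a, b be nonnegative integers. Set a' = min(a, m), b' = min(b, n), J = (x^m, x^a y^b g, y^n) and J' = (x^{m−a'}, x^{a−a'} y^{b−b'} g, y^{n−b'}). Then, with respect to the lexicographic monomial order with x > y, LT(J) = (x^m, y^n) + x^{a'} y^{b'}·LT(J'), where the right-hand summand is the ideal generated by all products x^{a'} y^{b'}·u with u the leading monomial of a nonzero element of J'. -/
open MvPolynomial

/-- The set of leading monomials of nonzero elements of an ideal `I` of `K[x,y]`. -/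
def ltMon {K : Type*} [Field K] (I : Ideal (MvPolynomial (Fin 2) K)) :
    Set (MvPolynomial (Fin 2) K) :=
  {q | ∃ g ∈ I, g ≠ 0 ∧ ∃ i j : ℕ, LeadPair g i j ∧ q = X 0 ^ i * X 1 ^ j}

lemma X_pow_mul_X_pow_eq_monomial {K : Type*} [Field K] (a b : ℕ) :
    (X 0 ^ a * X 1 ^ b : MvPolynomial (Fin 2) K)
      = monomial (Finsupp.single 0 a + Finsupp.single 1 b) 1 := by
  simp [X_pow_eq_monomial, monomial_mul]

lemma single_add_single_le_iff (a b i j : ℕ) :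
    (Finsupp.single 0 a + Finsupp.single 1 b : Fin 2 →₀ ℕ)
      ≤ Finsupp.single 0 i + Finsupp.single 1 j ↔ a ≤ i ∧ b ≤ j := by
  simp [Finsupp.le_def, Fin.forall_fin_two]

lemma single_add_single_inj (a b i j : ℕ) :
    (Finsupp.single 0 a + Finsupp.single 1 b : Fin 2 →₀ ℕ)
      = Finsupp.single 0 i + Finsupp.single 1 j ↔ a = i ∧ b = j := by
  simp [Finsupp.ext_iff, Fin.forall_fin_two]

lemma eq_single_add_single (u : Fin 2 →₀ ℕ) :
    u = Finsupp.single 0 (u 0) + Finsupp.single 1 (u 1) := by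
  simp [Finsupp.ext_iff, Fin.forall_fin_two]

lemma coeff_X_pow_mul_X_pow_mul {K : Type*} [Field K] (p : MvPolynomial (Fin 2) K)
    (a b i j : ℕ) :
    coeff (Finsupp.single 0 i + Finsupp.single 1 j) (X 0 ^ a * X 1 ^ b * p)
      = if a ≤ i ∧ b ≤ j then
          coeff (Finsupp.single 0 (i - a) + Finsupp.single 1 (j - b)) p else 0 := by
  rw [X_pow_mul_X_pow_eq_monomial, coeff_monomial_mul', one_mul]
  simp only [single_add_single_le_iff]
  congr 2
  simp [Finsupp.ext_iff, Fin.forall_fin_two]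

lemma coeff_eq_zero_of_mem_span_X_pow {K : Type*} [Field K] {p : MvPolynomial (Fin 2) K}
    {r s i j : ℕ} (hp : p ∈ Ideal.span {X 0 ^ r, X 1 ^ s}) (hi : i < r) (hj : j < s) :
    coeff (Finsupp.single 0 i + Finsupp.single 1 j) p = 0 := by
  obtain ⟨A, B, rfl⟩ := Ideal.mem_span_pair.1 hp
  have hA := coeff_X_pow_mul_X_pow_mul A r 0 i j
  have hB := coeff_X_pow_mul_X_pow_mul B 0 s i j
  rw [if_neg (by omega)] at hA hB
  rw [pow_zero, mul_one, mul_comm] at hA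
  rw [pow_zero, one_mul, mul_comm] at hB
  rw [coeff_add, hA, hB, add_zero]

/-- Modulo `(x^r, y^s)` every polynomial can be truncated to exponents below `(r, s)`. -/
lemma exists_truncation {K : Type*} [Field K] (r s : ℕ) (p : MvPolynomial (Fin 2) K) :
    ∃ q, p - q ∈ Ideal.span {(X 0 ^ r : MvPolynomial (Fin 2) K), X 1 ^ s} ∧
      ∀ i j, coeff (Finsupp.single 0 i + Finsupp.single 1 j) q
        = if i < r ∧ j < s then coeff (Finsupp.single 0 i + Finsupp.single 1 j) p else 0 := by
  induction p using MvPolynomial.induction_on' with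
  | monomial u c =>
    by_cases hu : u 0 < r ∧ u 1 < s
    · refine ⟨monomial u c, by simp, fun i j => ?_⟩
      rw [eq_single_add_single u, coeff_monomial]
      simp only [single_add_single_inj]
      grind
    · refine ⟨0, ?_, fun i j => ?_⟩
      · have hfac : monomial u c = C c * (X 0 ^ u 0 * X 1 ^ u 1) := by
          rw [X_pow_mul_X_pow_eq_monomial, ← eq_single_add_single, C_mul_monomial, mul_one]
        rw [sub_zero, hfac]
        apply Ideal.mul_mem_left
        by_cases h0 : r ≤ u 0
        · exact Ideal.mul_mem_right _ _ (Ideal.mem_of_dvd _ (pow_dvd_pow _ h0)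
            (Ideal.subset_span (by simp)))
        · exact Ideal.mul_mem_left _ _ (Ideal.mem_of_dvd _ (pow_dvd_pow _ (show s ≤ u 1 by omega))
            (Ideal.subset_span (by simp)))
      · rw [eq_single_add_single u, coeff_monomial, coeff_zero]
        simp only [single_add_single_inj]
        grind
  | add p₁ p₂ h₁ h₂ =>
    obtain ⟨q₁, hq₁, hc₁⟩ := h₁
    obtain ⟨q₂, hq₂, hc₂⟩ := h₂
    refine ⟨q₁ + q₂, by simpa [add_sub_add_comm] using add_mem hq₁ hq₂, fun i j => ?_⟩
    rw [coeff_add, coeff_add, hc₁, hc₂]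
    split_ifs <;> simp

lemma LeadPair.ne_zero {K : Type*} [Field K] {p : MvPolynomial (Fin 2) K} {i j : ℕ}
    (h : LeadPair p i j) : p ≠ 0 := by
  rintro rfl
  exact h.1 (coeff_zero _)

lemma LeadPair.X_pow_mul_X_pow_mul {K : Type*} [Field K] {p : MvPolynomial (Fin 2) K}
    {i j : ℕ} (h : LeadPair p i j) (a b : ℕ) :
    LeadPair (X 0 ^ a * X 1 ^ b * p) (a + i) (b + j) := by
  refine ⟨?_, fun i' j' h' => ?_⟩
  · rw [coeff_X_pow_mul_X_pow_mul, if_pos (by omega)]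
    simpa using h.1
  · rw [coeff_X_pow_mul_X_pow_mul] at h'
    split_ifs at h' with hle
    · have := h.2 _ _ h'
      omega
    · exact absurd rfl h'

lemma leadPair_one {K : Type*} [Field K] : LeadPair (1 : MvPolynomial (Fin 2) K) 0 0 := by
  refine ⟨by simp, fun i j h => ?_⟩
  by_contra hij
  refine h ?_
  rw [coeff_one, if_neg]
  have := single_add_single_inj 0 0 i j
  simp only [Finsupp.single_zero, add_zero] at this
  rw [this]
  omega

lemma X_pow_mul_X_pow_mem_ltMon {K : Type*} [Field K] {I : Ideal (MvPolynomial (Fin 2) K)}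
    {i j : ℕ} (h : X 0 ^ i * X 1 ^ j ∈ I) : X 0 ^ i * X 1 ^ j ∈ ltMon I := by
  have hl := (leadPair_one (K := K)).X_pow_mul_X_pow_mul i j
  rw [mul_one] at hl
  exact ⟨_, h, hl.ne_zero, i, j, hl, rfl⟩

/-- With `J = (x^m, x^a y^b g, y^n)` and `J' = (x^{m-a'}, x^{a-a'} y^{b-b'} g, y^{n-b'})`,
where `a' = min a m` and `b' = min b n`, we have `LT(J) = (x^m, y^n) + x^{a'} y^{b'} LT(J')`. -/
theorem stmt8 (K : Type*) [Field K] (g : MvPolynomial (Fin 2) K) (m n a b : ℕ) :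
    Ideal.span (ltMon (Ideal.span ({X 0 ^ m, X 0 ^ a * X 1 ^ b * g, X 1 ^ n} :
        Set (MvPolynomial (Fin 2) K))))
      = Ideal.span (({X 0 ^ m, X 1 ^ n} : Set (MvPolynomial (Fin 2) K)) ∪
          (fun q => X 0 ^ (min a m) * X 1 ^ (min b n) * q) ''
            ltMon (Ideal.span ({X 0 ^ (m - min a m),
              X 0 ^ (a - min a m) * X 1 ^ (b - min b n) * g, X 1 ^ (n - min b n)} :
              Set (MvPolynomial (Fin 2) K)))) := by
  have ha : min a m ≤ a := min_le_left _ _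
  have hm : min a m ≤ m := min_le_right _ _
  have hb : min b n ≤ b := min_le_left _ _
  have hn : min b n ≤ n := min_le_right _ _
  generalize min a m = a' at *
  generalize min b n = b' at *
  have hmid : X 0 ^ a * X 1 ^ b * g
      = X 0 ^ a' * X 1 ^ b' * (X 0 ^ (a - a') * X 1 ^ (b - b') * g) := by
    nth_rewrite 1 [← Nat.add_sub_cancel' ha, ← Nat.add_sub_cancel' hb]
    ring
  apply le_antisymm <;> rw [Ideal.span_le]
  · rintro _ ⟨f, hf, -, i, j, hl, rfl⟩
    by_cases hi : m ≤ i
    · exact Ideal.mul_mem_right _ _ (Ideal.mem_of_dvd _ (pow_dvd_pow _ hi)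
        (Ideal.subset_span (by simp)))
    by_cases hj : n ≤ j
    · exact Ideal.mul_mem_left _ _ (Ideal.mem_of_dvd _ (pow_dvd_pow _ hj)
        (Ideal.subset_span (by simp)))
    push Not at hi hj
    rw [Set.insert_comm, Ideal.mem_span_insert] at hf
    obtain ⟨c, z, hz, rfl⟩ := hf
    obtain ⟨q, hq, hqc⟩ := exists_truncation (m - a') (n - b')
      (c * (X 0 ^ (a - a') * X 1 ^ (b - b') * g))
    have hcoeff : ∀ k l, k < m → l < n →
        coeff (Finsupp.single 0 k + Finsupp.single 1 l) (c * (X 0 ^ a * X 1 ^ b * g) + z)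
          = if a' ≤ k ∧ b' ≤ l then
              coeff (Finsupp.single 0 (k - a') + Finsupp.single 1 (l - b')) q else 0 := by
      intro k l hk hl
      rw [coeff_add, coeff_eq_zero_of_mem_span_X_pow hz hk hl, add_zero, hmid, mul_left_comm,
        coeff_X_pow_mul_X_pow_mul]
      split_ifs with h
      · rw [hqc, if_pos (by omega)]
      · rfl
    have hle : a' ≤ i ∧ b' ≤ j := by
      by_contra h
      exact hl.1 (by rw [hcoeff i j hi hj, if_neg h])
    have hlq : LeadPair q (i - a') (j - b') := by
      refine ⟨?_, fun k l hkl => ?_⟩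
      · have := hl.1
        rwa [hcoeff i j hi hj, if_pos hle] at this
      · have hlt : k < m - a' ∧ l < n - b' := by
          by_contra h
          exact hkl (by rw [hqc, if_neg h])
        have := hl.2 (k + a') (l + b') (by
          rw [hcoeff _ _ (by omega) (by omega), if_pos (by omega)]
          simpa using hkl)
        omega
    refine Ideal.subset_span (Or.inr ⟨X 0 ^ (i - a') * X 1 ^ (j - b'),
      ⟨q, ?_, hlq.ne_zero, _, _, hlq, rfl⟩, ?_⟩)
    · rw [← sub_sub_cancel (c * (X 0 ^ (a - a') * X 1 ^ (b - b') * g)) q]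
      refine sub_mem (Ideal.mul_mem_left _ _ (Ideal.subset_span (by simp)))
        (Ideal.span_mono ?_ hq)
      rintro _ (rfl | rfl) <;> simp
    · nth_rewrite 2 [← Nat.add_sub_cancel' hle.1, ← Nat.add_sub_cancel' hle.2]
      ring
  · rintro _ ((rfl | rfl) | ⟨_, ⟨f, hf, -, i, j, hl, rfl⟩, rfl⟩)
    · have := X_pow_mul_X_pow_mem_ltMon (i := m) (j := 0)
        (I := Ideal.span {X 0 ^ m, X 0 ^ a * X 1 ^ b * g, X 1 ^ n})
        (Ideal.mul_mem_right _ _ (Ideal.subset_span (by simp)))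
      rw [pow_zero, mul_one] at this
      exact Ideal.subset_span this
    · have := X_pow_mul_X_pow_mem_ltMon (i := 0) (j := n)
        (I := Ideal.span {X 0 ^ m, X 0 ^ a * X 1 ^ b * g, X 1 ^ n})
        (Ideal.mul_mem_left _ _ (Ideal.subset_span (by simp)))
      rw [pow_zero, one_mul] at this
      exact Ideal.subset_span this
    · have hlM := hl.X_pow_mul_X_pow_mul a' b'
      refine Ideal.subset_span ⟨_, ?_, hlM.ne_zero, _, _, hlM, by ring⟩
      rw [Ideal.mem_span_insert] at hf
      obtain ⟨A, z, hz, rfl⟩ := hf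
      obtain ⟨B, C, rfl⟩ := Ideal.mem_span_pair.1 hz
      have hexp : X 0 ^ a' * X 1 ^ b' * (A * X 0 ^ (m - a')
            + (B * (X 0 ^ (a - a') * X 1 ^ (b - b') * g) + C * X 1 ^ (n - b')))
          = A * X 1 ^ b' * X 0 ^ m
            + (B * (X 0 ^ a * X 1 ^ b * g) + C * X 0 ^ a' * X 1 ^ n) := by
        rw [hmid, ← pow_mul_pow_sub (X 0) hm, ← pow_mul_pow_sub (X 1) hn]
        ring
      rw [hexp]
      exact add_mem (Ideal.mul_mem_left _ _ (Ideal.subset_span (by simp)))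
        (add_mem (Ideal.mul_mem_left _ _ (Ideal.subset_span (by simp)))
          (Ideal.mul_mem_left _ _ (Ideal.subset_span (by simp))))
end

section
/- Let K be a field, let g ∈ K[x,y] be any polynomial, and let m, n, a, b be nonnegative integers. Set a' = min(a, m), b' = min(b, n), J = (x^m, x^a y^b g, y^n) and J' = (x^{m−a'}, x^{a−a'} y^{b−b'} g, y^{n−b'}). Then the quotients K[x,y]/J and K[x,y]/J' are finite-dimensional K-vector spaces, and dim_K K[x,y]/J = m·b' + (n − b')·a' + dim_K K[x,y]/J'. -/
open MvPolynomial

/-- The ideal `J = (x^m, x^a y^b g, y^n)` of `K[x,y]`. -/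
noncomputable def Jgen (K : Type*) [Field K] (g : MvPolynomial (Fin 2) K) (m n a b : ℕ) :
    Ideal (MvPolynomial (Fin 2) K) :=
  Ideal.span ({X 0 ^ m, X 0 ^ a * X 1 ^ b * g, X 1 ^ n} : Set (MvPolynomial (Fin 2) K))

/-- If `p ≠ 0` and `p`, `w` are relatively prime, then multiplication by `p` gives a short exact
sequence `0 → R/(I + (w)) → R/(pI + (w)) → R/(p, w) → 0`; here its effect on dimensions. -/
lemma finite_and_finrank_quotient_span_singleton_mul_sup {K R : Type*} [Field K] [CommRing R]
    [IsDomain R] [DecompositionMonoid R] [Algebra K R] {p w : R} (hp : p ≠ 0)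
    (hpw : IsRelPrime p w) (I : Ideal R)
    [Module.Finite K (R ⧸ (I ⊔ Ideal.span {w}))]
    [Module.Finite K (R ⧸ (Ideal.span {p} ⊔ Ideal.span {w}))] :
    Module.Finite K (R ⧸ (Ideal.span {p} * I ⊔ Ideal.span {w})) ∧
    Module.finrank K (R ⧸ (Ideal.span {p} * I ⊔ Ideal.span {w})) =
      Module.finrank K (R ⧸ (Ideal.span {p} ⊔ Ideal.span {w})) +
      Module.finrank K (R ⧸ (I ⊔ Ideal.span {w})) := by
  set J := Ideal.span {p} * I ⊔ Ideal.span {w}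
  set L := Ideal.span {p} ⊔ Ideal.span {w}
  have hJL : J ≤ L := sup_le_sup_right Ideal.mul_le_left _
  have hmul (r : R) : p * r ∈ J ↔ r ∈ I ⊔ Ideal.span {w} := by
    simp only [J, Submodule.mem_sup, Ideal.mem_span_singleton_mul, Ideal.mem_span_singleton]
    constructor
    · rintro ⟨_, ⟨i, hi, rfl⟩, _, ⟨c, rfl⟩, h⟩
      obtain ⟨d, rfl⟩ : p ∣ c := hpw.dvd_of_dvd_mul_left ⟨r - i, by linear_combination h⟩
      exact ⟨i, hi, w * d, ⟨d, rfl⟩, mul_left_cancel₀ hp (by linear_combination h)⟩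
    · rintro ⟨i, hi, _, ⟨c, rfl⟩, rfl⟩
      exact ⟨p * i, ⟨i, hi, rfl⟩, w * (p * c), ⟨p * c, rfl⟩, by ring⟩
  let f : (R ⧸ (I ⊔ Ideal.span {w})) →ₗ[K] R ⧸ J :=
    (Submodule.mapQ _ J (LinearMap.lsmul R R p) fun r hr ↦ (hmul r).2 hr).restrictScalars K
  let g : (R ⧸ J) →ₗ[K] R ⧸ L := (Ideal.Quotient.factorₐ K hJL).toLinearMap
  have hf (r : R) : f (Ideal.Quotient.mk _ r) = Ideal.Quotient.mk J (p * r) := rfl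
  have hg (r : R) : g (Ideal.Quotient.mk _ r) = Ideal.Quotient.mk L r := rfl
  have hg_surj : Function.Surjective g := Ideal.Quotient.factor_surjective hJL
  have hf_inj : Function.Injective f := by
    rw [injective_iff_map_eq_zero]
    intro r
    obtain ⟨r, rfl⟩ := Ideal.Quotient.mk_surjective r
    rw [hf, Ideal.Quotient.eq_zero_iff_mem, Ideal.Quotient.eq_zero_iff_mem]
    exact (hmul r).1
  have hfg : Function.Exact f g := by
    intro r
    obtain ⟨r, rfl⟩ := Ideal.Quotient.mk_surjective r
    rw [hg, Ideal.Quotient.eq_zero_iff_mem]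
    constructor
    · simp only [L, Submodule.mem_sup, Ideal.mem_span_singleton]
      rintro ⟨_, ⟨c, rfl⟩, d, hd, rfl⟩
      refine ⟨Ideal.Quotient.mk _ c, ?_⟩
      rw [hf, Ideal.Quotient.eq]
      have : d ∈ J := Ideal.mem_sup_right (Ideal.mem_span_singleton.2 hd)
      simpa using this
    · rintro ⟨s, hs⟩
      obtain ⟨s, rfl⟩ := Ideal.Quotient.mk_surjective s
      rw [hf, Ideal.Quotient.eq] at hs
      have hps : p * s ∈ L :=
        Ideal.mem_sup_left (Ideal.mul_mem_right _ _ (Ideal.mem_span_singleton_self p))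
      simpa using sub_mem hps (hJL hs)
  have hfin : Module.Finite K (R ⧸ J) := .of_exact hfg hg_surj
  refine ⟨hfin, ?_⟩
  rw [← g.finrank_range_add_finrank_ker, LinearMap.exact_iff.1 hfg,
    LinearMap.finrank_range_of_inj hf_inj, LinearMap.range_eq_top.2 hg_surj, finrank_top]

/-- A quotient by a larger ideal stays finite. -/
lemma Ideal.finite_quotient_of_le {K R : Type*} [Field K] [CommRing R] [Algebra K R]
    {I J : Ideal R} (h : I ≤ J) [Module.Finite K (R ⧸ I)] : Module.Finite K (R ⧸ J) :=
  .of_surjective (Ideal.Quotient.factorₐ K h).toLinearMap (Ideal.Quotient.factor_surjective h)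

namespace MvPolynomial

variable {K : Type*} [Field K]

lemma isRelPrime_X_pow {σ : Type*} {i j : σ} (hij : i ≠ j) (m n : ℕ) :
    IsRelPrime (X i ^ m : MvPolynomial σ K) (X j ^ n) := by
  refine IsRelPrime.pow ((X_prime).irreducible.isRelPrime_iff_not_dvd.2 ?_)
  simpa [X_dvd_X] using hij

lemma finite_and_finrank_quotient_span_X :
    Module.Finite K (MvPolynomial (Fin 2) K ⧸
      (Ideal.span {X 1} ⊔ Ideal.span {X 0} : Ideal (MvPolynomial (Fin 2) K))) ∧
    Module.finrank K (MvPolynomial (Fin 2) K ⧸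
      (Ideal.span {X 1} ⊔ Ideal.span {X 0} : Ideal (MvPolynomial (Fin 2) K))) = 1 := by
  have hker : (Ideal.span {X 1} ⊔ Ideal.span {X 0} : Ideal (MvPolynomial (Fin 2) K)) =
      RingHom.ker (aeval (0 : Fin 2 → K)) := by
    have : (Ideal.span {X 1} ⊔ Ideal.span {X 0} : Ideal (MvPolynomial (Fin 2) K)) =
        idealOfVars (Fin 2) K := by
      rw [← Ideal.span_union, idealOfVars]
      congr 1
      ext p
      simp [Fin.exists_fin_two, eq_comm]
    rw [this]
    ext p
    rw [← pow_one (idealOfVars (Fin 2) K), mem_pow_idealOfVars_iff']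
    simp [RingHom.mem_ker, constantCoeff_eq, Finsupp.degree_eq_zero_iff]
  have e := Ideal.quotientKerAlgEquivOfSurjective (f := aeval (R := K) (0 : Fin 2 → K))
    fun c ↦ ⟨C c, by simp⟩
  rw [hker]
  exact ⟨.equiv e.symm.toLinearEquiv, by
    rw [e.toLinearEquiv.finrank_eq, Module.finrank_self]⟩

lemma finite_and_finrank_quotient_span_X_pow_sup_span_X (n : ℕ) :
    Module.Finite K (MvPolynomial (Fin 2) K ⧸
      (Ideal.span {X 1 ^ n} ⊔ Ideal.span {X 0} : Ideal (MvPolynomial (Fin 2) K))) ∧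
    Module.finrank K (MvPolynomial (Fin 2) K ⧸
      (Ideal.span {X 1 ^ n} ⊔ Ideal.span {X 0} : Ideal (MvPolynomial (Fin 2) K))) = n := by
  induction n with
  | zero =>
    have : (Ideal.span {X 1 ^ 0} ⊔ Ideal.span {X 0} : Ideal (MvPolynomial (Fin 2) K)) = ⊤ := by
      simp
    rw [this]
    exact ⟨inferInstance, Module.finrank_zero_of_subsingleton⟩
  | succ n ih =>
    obtain ⟨_, hn⟩ := ih
    obtain ⟨_, h1⟩ := finite_and_finrank_quotient_span_X (K := K)
    have h := finite_and_finrank_quotient_span_singleton_mul_sup (K := K)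
      (X_ne_zero (R := K) (1 : Fin 2)) (w := X 0)
      (by simpa using isRelPrime_X_pow (K := K) (one_ne_zero (α := Fin 2)) 1 1)
      (Ideal.span {X 1 ^ n})
    rw [Ideal.span_singleton_mul_span_singleton, ← pow_succ', hn, h1] at h
    exact ⟨h.1, by rw [h.2, add_comm]⟩

lemma finite_and_finrank_quotient_span_X_pow_sup_span_X_pow (m n : ℕ) :
    Module.Finite K (MvPolynomial (Fin 2) K ⧸
      (Ideal.span {X 0 ^ m} ⊔ Ideal.span {X 1 ^ n} : Ideal (MvPolynomial (Fin 2) K))) ∧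
    Module.finrank K (MvPolynomial (Fin 2) K ⧸
      (Ideal.span {X 0 ^ m} ⊔ Ideal.span {X 1 ^ n} : Ideal (MvPolynomial (Fin 2) K))) =
        m * n := by
  induction m with
  | zero =>
    have : (Ideal.span {X 0 ^ 0} ⊔ Ideal.span {X 1 ^ n} : Ideal (MvPolynomial (Fin 2) K)) = ⊤ := by
      simp
    rw [this, zero_mul]
    exact ⟨inferInstance, Module.finrank_zero_of_subsingleton⟩
  | succ m ih =>
    obtain ⟨_, hm⟩ := ih
    obtain ⟨h1, h1'⟩ := finite_and_finrank_quotient_span_X_pow_sup_span_X (K := K) n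
    rw [sup_comm] at h1 h1'
    have h := finite_and_finrank_quotient_span_singleton_mul_sup (K := K)
      (X_ne_zero (R := K) (0 : Fin 2)) (w := X 1 ^ n)
      (by simpa using isRelPrime_X_pow (K := K) (zero_ne_one (α := Fin 2)) 1 n)
      (Ideal.span {X 0 ^ m})
    rw [Ideal.span_singleton_mul_span_singleton, ← pow_succ', hm, h1'] at h
    exact ⟨h.1, by rw [h.2]; ring⟩

end MvPolynomial

/-- The quotient by `Jgen` is finite-dimensional, as `Jgen` contains `(x^m, y^n)`. -/
lemma finite_quotient_Jgen (K : Type*) [Field K] (g : MvPolynomial (Fin 2) K) (m n a b : ℕ) :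
    Module.Finite K (MvPolynomial (Fin 2) K ⧸ Jgen K g m n a b) := by
  have := (finite_and_finrank_quotient_span_X_pow_sup_span_X_pow (K := K) m n).1
  refine Ideal.finite_quotient_of_le
    (I := Ideal.span {X 0 ^ m} ⊔ Ideal.span {X 1 ^ n}) (K := K) ?_
  rw [← Ideal.span_union]
  refine Ideal.span_mono ?_
  rintro _ (rfl | rfl) <;> simp

/-- Splitting off a common power of `y`. -/
lemma finrank_quotient_Jgen_add_right (K : Type*) [Field K] (g : MvPolynomial (Fin 2) K)
    (m n a b k : ℕ) :
    Module.finrank K (MvPolynomial (Fin 2) K ⧸ Jgen K g m (n + k) a (b + k)) =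
      m * k + Module.finrank K (MvPolynomial (Fin 2) K ⧸ Jgen K g m n a b) := by
  obtain ⟨h1, h1'⟩ := finite_and_finrank_quotient_span_X_pow_sup_span_X_pow (K := K) m k
  have h2 := finite_quotient_Jgen K g m n a b
  have hI : Jgen K g m n a b =
      Ideal.span {X 0 ^ a * X 1 ^ b * g, X 1 ^ n} ⊔ Ideal.span {X 0 ^ m} := by
    rw [Jgen, Ideal.span_insert, sup_comm]
  have hJ : Jgen K g m (n + k) a (b + k) = Ideal.span {X 1 ^ k} *
      Ideal.span {X 0 ^ a * X 1 ^ b * g, X 1 ^ n} ⊔ Ideal.span {X 0 ^ m} := by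
    rw [Jgen, Ideal.span_insert, sup_comm, Ideal.span_insert, Ideal.span_insert, Ideal.mul_sup,
      Ideal.span_singleton_mul_span_singleton, Ideal.span_singleton_mul_span_singleton]
    ring_nf
  rw [hI] at h2 ⊢
  rw [sup_comm] at h1 h1'
  rw [hJ, ← h1']
  exact (finite_and_finrank_quotient_span_singleton_mul_sup (R := MvPolynomial (Fin 2) K)
    (pow_ne_zero _ (X_ne_zero _)) (isRelPrime_X_pow one_ne_zero _ _) _).2

/-- Splitting off a common power of `x`. -/
lemma finrank_quotient_Jgen_add_left (K : Type*) [Field K] (g : MvPolynomial (Fin 2) K)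
    (m n a b k : ℕ) :
    Module.finrank K (MvPolynomial (Fin 2) K ⧸ Jgen K g (m + k) n (a + k) b) =
      n * k + Module.finrank K (MvPolynomial (Fin 2) K ⧸ Jgen K g m n a b) := by
  obtain ⟨h1, h1'⟩ := finite_and_finrank_quotient_span_X_pow_sup_span_X_pow (K := K) k n
  have h2 := finite_quotient_Jgen K g m n a b
  have hI : Jgen K g m n a b =
      Ideal.span {X 0 ^ m, X 0 ^ a * X 1 ^ b * g} ⊔ Ideal.span {X 1 ^ n} := by
    rw [Jgen, Ideal.span_insert, Ideal.span_insert, Ideal.span_insert, sup_assoc]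
  have hJ : Jgen K g (m + k) n (a + k) b = Ideal.span {X 0 ^ k} *
      Ideal.span {X 0 ^ m, X 0 ^ a * X 1 ^ b * g} ⊔ Ideal.span {X 1 ^ n} := by
    rw [Jgen, Ideal.span_insert, Ideal.span_insert, Ideal.span_insert, Ideal.mul_sup, sup_assoc,
      Ideal.span_singleton_mul_span_singleton, Ideal.span_singleton_mul_span_singleton]
    ring_nf
  rw [hI] at h2 ⊢
  rw [hJ, mul_comm n k, ← h1']
  exact (finite_and_finrank_quotient_span_singleton_mul_sup (R := MvPolynomial (Fin 2) K)
    (pow_ne_zero _ (X_ne_zero _)) (isRelPrime_X_pow zero_ne_one _ _) _).2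

/-- With `a' = min a m`, `b' = min b n`, `J = (x^m, x^a y^b g, y^n)`, and
`J' = (x^{m-a'}, x^{a-a'} y^{b-b'} g, y^{n-b'})`, the quotients by `J` and `J'` are
finite-dimensional and `dim K[x,y]/J = m b' + (n - b') a' + dim K[x,y]/J'`. -/
theorem stmt9 (K : Type*) [Field K] (g : MvPolynomial (Fin 2) K) (m n a b : ℕ) :
    FiniteDimensional K (MvPolynomial (Fin 2) K ⧸ Jgen K g m n a b) ∧
    FiniteDimensional K
      (MvPolynomial (Fin 2) K ⧸ Jgen K g (m - min a m) (n - min b n) (a - min a m) (b - min b n)) ∧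
    Module.finrank K (MvPolynomial (Fin 2) K ⧸ Jgen K g m n a b)
      = m * (min b n) + (n - min b n) * (min a m) +
        Module.finrank K (MvPolynomial (Fin 2) K ⧸
          Jgen K g (m - min a m) (n - min b n) (a - min a m) (b - min b n)) := by
  refine ⟨finite_quotient_Jgen .., finite_quotient_Jgen .., ?_⟩
  have hy := finrank_quotient_Jgen_add_right K g m (n - min b n) a (b - min b n) (min b n)
  have hx := finrank_quotient_Jgen_add_left K g (m - min a m) (n - min b n) (a - min a m)
    (b - min b n) (min a m)
  rw [Nat.sub_add_cancel (min_le_left _ _), Nat.sub_add_cancel (min_le_right _ _)] at hx hy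
  rw [hy, hx, add_assoc]
end
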